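/- arXiv:2204.01336 — 3 statements merged into one kernel-verified Lean document; each statement's English description precedes it below -/
import Mathlib

section
/- There exists a constant c > 0, namely c = 𝓑(√3)/Φ(√3), such that 𝓑(x) = c·Φ(x) for all x ≥ √3. -/
open MeasureTheory

noncomputable section

/-- The dyadic subinterval `[k/2^n, (k+1)/2^n]` of `[0,1]`. -/
def dyadicI (n k : ℕ) : Set ℝ := Set.Icc ((k : ℝ) / 2 ^ n) (((k : ℝ) + 1) / 2 ^ n)

/-- The Haar function of the dyadic interval `[k/2^n, (k+1)/2^n]`: it equals `-1` on the
left half of the interval, `+1` on its right half and `0` elsewhere. -/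
def haar (n k : ℕ) (x : ℝ) : ℝ :=
  if x ∈ Set.Ico ((k : ℝ) / 2 ^ n) ((2 * (k : ℝ) + 1) / 2 ^ (n + 1)) then -1
  else if x ∈ Set.Ico ((2 * (k : ℝ) + 1) / 2 ^ (n + 1)) (((k : ℝ) + 1) / 2 ^ n) then 1
  else 0

/-- The Haar coefficient `a_J = μ(J)⁻¹ ∫_I f h_J` of `f` at `J = [k/2^n, (k+1)/2^n]`. -/
def haarCoeff (f : ℝ → ℝ) (n k : ℕ) : ℝ :=
  2 ^ n * ∫ x in Set.Icc (0 : ℝ) 1, f x * haar n k x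

/-- The dyadic square function `Sf = √(Σ_J a_J² χ_J)`. -/
def sqFn (f : ℝ → ℝ) (x : ℝ) : ℝ :=
  Real.sqrt (∑' p : ℕ × ℕ, (haarCoeff f p.1 p.2) ^ 2 * (dyadicI p.1 p.2).indicator 1 x)

/-- A test function for the Bellman function: integrable on `I = [0,1]`, with zero mean
and with dyadic square function essentially bounded by `1` on `I`. -/
def Admissible (f : ℝ → ℝ) : Prop :=
  IntegrableOn f (Set.Icc 0 1) ∧ (∫ x in Set.Icc (0 : ℝ) 1, f x) = 0 ∧
    ∀ᵐ x ∂(volume.restrict (Set.Icc (0 : ℝ) 1)), sqFn f x ≤ 1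

/-- The Bellman function `𝓑(x) = sup{ μ{f ≥ x} : ∫_I f = 0, ‖Sf‖_∞ ≤ 1 }`. -/
def bellman (x : ℝ) : ℝ :=
  sSup { m : ℝ | ∃ f : ℝ → ℝ, Admissible f ∧
    m = (volume { y ∈ Set.Icc (0 : ℝ) 1 | x ≤ f y }).toReal }

/-- The Gaussian tail function `Φ(x) = ∫ₓ^∞ e^{-y²/2} dy`. -/
def gaussPhi (x : ℝ) : ℝ := ∫ y in Set.Ioi x, Real.exp (-y ^ 2 / 2)

lemma integrable_exp_neg_sq_div_two : Integrable (fun y : ℝ => Real.exp (-y ^ 2 / 2)) := by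
  have h := integrable_exp_neg_mul_sq (b := 1 / 2) (by norm_num)
  refine h.congr (Filter.Eventually.of_forall fun y => ?_)
  simp only
  congr 1
  ring

lemma gaussPhi_eq_sub (x : ℝ) :
    gaussPhi x = gaussPhi 0 - ∫ y in (0 : ℝ)..x, Real.exp (-y ^ 2 / 2) := by
  have h := intervalIntegral.integral_Ioi_sub_Ioi' (f := fun y : ℝ => Real.exp (-y ^ 2 / 2))
    (a := 0) (b := x) integrable_exp_neg_sq_div_two.integrableOn
    integrable_exp_neg_sq_div_two.integrableOn
  unfold gaussPhi
  linarith

lemma hasDerivAt_gaussPhi (x : ℝ) : HasDerivAt gaussPhi (-Real.exp (-x ^ 2 / 2)) x := by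
  have hc : Continuous fun y : ℝ => Real.exp (-y ^ 2 / 2) := by fun_prop
  have h := (hc.integral_hasStrictDerivAt 0 x).hasDerivAt.const_sub (gaussPhi 0)
  exact h.congr_of_eventuallyEq (Filter.Eventually.of_forall gaussPhi_eq_sub)

lemma continuous_gaussPhi : Continuous gaussPhi :=
  continuous_iff_continuousAt.2 fun x => (hasDerivAt_gaussPhi x).continuousAt

lemma gaussPhi_strictAnti : StrictAnti gaussPhi :=
  strictAnti_of_deriv_neg fun x => by
    rw [(hasDerivAt_gaussPhi x).deriv]
    exact neg_neg_of_pos (Real.exp_pos _)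

lemma gaussPhi_nonneg (x : ℝ) : 0 ≤ gaussPhi x :=
  setIntegral_nonneg measurableSet_Ioi fun _ _ => (Real.exp_pos _).le

lemma gaussPhi_pos (x : ℝ) : 0 < gaussPhi x :=
  (gaussPhi_nonneg (x + 1)).trans_lt (gaussPhi_strictAnti (lt_add_one x))

lemma tendsto_gaussPhi_atTop : Filter.Tendsto gaussPhi Filter.atTop (nhds 0) := by
  have h := intervalIntegral_tendsto_integral_Ioi (0 : ℝ)
    (integrable_exp_neg_sq_div_two.integrableOn (s := Set.Ioi 0)) Filter.tendsto_id
  have h2 := h.const_sub (gaussPhi 0)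
  have h3 : gaussPhi 0 - ∫ y in Set.Ioi (0 : ℝ), Real.exp (-y ^ 2 / 2) = 0 := sub_self _
  rw [h3] at h2
  exact h2.congr fun x => (gaussPhi_eq_sub x).symm

/-- The sum of the values of `gaussPhi` at the two points reached from `z` by a jump of relative
size `a`, after rescaling. -/
def gaussPhiPair (z a : ℝ) : ℝ :=
  gaussPhi ((z - a) / √(1 - a ^ 2)) + gaussPhi ((z + a) / √(1 - a ^ 2))

lemma gaussPhiPair_zero (z : ℝ) : gaussPhiPair z 0 = 2 * gaussPhi z := by
  simp [gaussPhiPair]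
  ring

lemma gaussPhiPair_neg (z a : ℝ) : gaussPhiPair z (-a) = gaussPhiPair z a := by
  simp [gaussPhiPair, add_comm, sub_eq_add_neg]

lemma one_sub_sq_pos_of_mem {a : ℝ} (ha : a ∈ Set.Ico (0 : ℝ) 1) : 0 < 1 - a ^ 2 := by
  nlinarith [ha.1, ha.2]

lemma hasDerivAt_gaussPhiPair (z : ℝ) {a : ℝ} (ha : a ∈ Set.Ico (0 : ℝ) 1) :
    HasDerivAt (gaussPhiPair z)
      (Real.exp (-((z - a) / √(1 - a ^ 2)) ^ 2 / 2) / √(1 - a ^ 2) ^ 3 *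
        ((1 - a * z) - (1 + a * z) * Real.exp (-(2 * (a * z) / (1 - a ^ 2))))) a := by
  have hp := one_sub_sq_pos_of_mem ha
  have hs : 0 < √(1 - a ^ 2) := Real.sqrt_pos.2 hp
  have hsq : √(1 - a ^ 2) ^ 2 = 1 - a ^ 2 := Real.sq_sqrt hp.le
  have h1 : HasDerivAt (fun a : ℝ => 1 - a ^ 2) (-(2 * a)) a := by
    simpa using (hasDerivAt_pow 2 a).const_sub 1
  have h2 := h1.sqrt hp.ne'
  have hu := ((hasDerivAt_id a).const_sub z).div h2 hs.ne'
  have hv := ((hasDerivAt_id a).const_add z).div h2 hs.ne'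
  have h3 := ((hasDerivAt_gaussPhi _).comp a hu).add ((hasDerivAt_gaussPhi _).comp a hv)
  refine h3.congr_deriv ?_
  have hexp : Real.exp (-((z + a) / √(1 - a ^ 2)) ^ 2 / 2) =
      Real.exp (-((z - a) / √(1 - a ^ 2)) ^ 2 / 2) *
        Real.exp (-(2 * (a * z) / (1 - a ^ 2))) := by
    rw [← Real.exp_add]
    congr 1
    rw [div_pow, div_pow, hsq]
    field_simp
    ring
  simp only [id, Pi.div_apply]
  rw [hexp]
  generalize Real.exp (-((z - a) / √(1 - a ^ 2)) ^ 2 / 2) = E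
  generalize Real.exp (-(2 * (a * z) / (1 - a ^ 2))) = F
  generalize √(1 - a ^ 2) = s at *
  have e1 : (-1 * s - (z - a) * (-(2 * a) / (2 * s))) / s ^ 2 = (a * z - 1) / s ^ 3 := by
    field_simp
    linear_combination -hsq
  have e2 : (1 * s - (z + a) * (-(2 * a) / (2 * s))) / s ^ 2 = (a * z + 1) / s ^ 3 := by
    field_simp
    linear_combination hsq
  rw [e1, e2]
  field_simp
  ring

lemma two_mul_div_le_log {s q : ℝ} (hs0 : 0 ≤ s) (hs1 : s < 1) (hq : q ≤ s ^ 2 / 3) :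
    2 * s / (1 - q) ≤ Real.log (1 + s) - Real.log (1 - s) := by
  have hs2 : s ^ 2 < 1 := by nlinarith
  have h1 : 2 * s / (1 - q) ≤ 2 * s / (1 - s ^ 2 / 3) := by
    apply div_le_div_of_nonneg_left (by positivity) (by linarith) (by linarith)
  refine h1.trans ?_
  have hmono : MonotoneOn (fun s : ℝ => Real.log (1 + s) - Real.log (1 - s) -
      2 * s / (1 - s ^ 2 / 3)) (Set.Ico 0 1) := by
    have hd : ∀ x ∈ Set.Ico (0 : ℝ) 1, HasDerivAt (fun s : ℝ => Real.log (1 + s) -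
        Real.log (1 - s) - 2 * s / (1 - s ^ 2 / 3))
        (1 / (1 + x) - (-1) / (1 - x) - (2 * (1 - x ^ 2 / 3) - 2 * x * (-(2 * x / 3))) /
          (1 - x ^ 2 / 3) ^ 2) x := by
      intro x hx
      have hx2 : x ^ 2 < 1 := by nlinarith [hx.1, hx.2]
      have a1 := ((hasDerivAt_id x).const_add 1).log (by simp; linarith [hx.1])
      have a2 := ((hasDerivAt_id x).const_sub 1).log (by simp; linarith [hx.2])
      have a3 : HasDerivAt (fun s : ℝ => 1 - s ^ 2 / 3) (-(2 * x / 3)) x := by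
        simpa using ((hasDerivAt_pow 2 x).div_const 3).const_sub 1
      have a4 : HasDerivAt (fun s : ℝ => 2 * s) 2 x := by
        simpa using (hasDerivAt_id x).const_mul 2
      exact (a1.sub a2).sub (a4.div a3 (by linarith))
    apply monotoneOn_of_deriv_nonneg (convex_Ico 0 1)
    · exact fun x hx => (hd x hx).continuousAt.continuousWithinAt
    · intro x hx
      rw [interior_Ico] at hx
      exact (hd x ⟨hx.1.le, hx.2⟩).differentiableAt.differentiableWithinAt
    · intro x hx
      rw [interior_Ico] at hx
      rw [(hd x ⟨hx.1.le, hx.2⟩).deriv]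
      have hx0 := hx.1
      have hx1 := hx.2
      have hx2 : x ^ 2 < 1 := by nlinarith
      have p1 : 0 < 1 - x := by linarith
      have p2 : 0 < 1 + x := by linarith
      have p3 : 0 < 1 - x ^ 2 / 3 := by linarith
      have : 1 / (1 + x) - (-1) / (1 - x) - (2 * (1 - x ^ 2 / 3) - 2 * x * (-(2 * x / 3))) /
          (1 - x ^ 2 / 3) ^ 2 =
          (8 / 9 * x ^ 4) / ((1 + x) * (1 - x) * (1 - x ^ 2 / 3) ^ 2) := by
        have := p1.ne'
        have := p2.ne'
        have := p3.ne'
        rw [div_sub_div _ _ (by positivity) (by positivity),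
          div_sub_div _ _ (by positivity) (by positivity),
          div_eq_div_iff (by positivity) (by positivity)]
        ring
      rw [this]
      positivity
  have := hmono (Set.left_mem_Ico.2 one_pos) ⟨hs0, hs1⟩ hs0
  simp at this
  linarith

/-- For `√3 ≤ z` the rescaled Gaussian tail is a supersolution for jumps of every size. -/
lemma gaussPhiPair_le {z : ℝ} (hz : √3 ≤ z) {a : ℝ} (ha : a ∈ Set.Ico (0 : ℝ) 1) :
    gaussPhiPair z a ≤ 2 * gaussPhi z := by
  have hz0 : 0 < z := lt_of_lt_of_le (by positivity) hz
  have hz2 : 3 ≤ z ^ 2 := by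
    have := Real.sq_sqrt (show (0 : ℝ) ≤ 3 by norm_num)
    nlinarith [Real.sqrt_nonneg 3]
  have hanti : AntitoneOn (gaussPhiPair z) (Set.Ico 0 1) := by
    apply antitoneOn_of_deriv_nonpos (convex_Ico 0 1)
    · exact fun x hx => (hasDerivAt_gaussPhiPair z hx).continuousAt.continuousWithinAt
    · exact fun x hx => (hasDerivAt_gaussPhiPair z
        (interior_subset hx)).differentiableAt.differentiableWithinAt
    · intro x hx
      have hx := interior_subset hx
      have hp := one_sub_sq_pos_of_mem hx
      rw [(hasDerivAt_gaussPhiPair z hx).deriv]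
      apply mul_nonpos_of_nonneg_of_nonpos (by positivity)
      have hs0 : 0 ≤ x * z := mul_nonneg hx.1 hz0.le
      rcases le_or_gt 1 (x * z) with h | h
      · have : 0 ≤ (1 + x * z) * Real.exp (-(2 * (x * z) / (1 - x ^ 2))) := by positivity
        linarith
      · have hl := two_mul_div_le_log hs0 h (q := x ^ 2) (by nlinarith [sq_nonneg x])
        have he : Real.exp (Real.log (1 - x * z) - Real.log (1 + x * z)) ≤
            Real.exp (-(2 * (x * z) / (1 - x ^ 2))) := Real.exp_le_exp.2 (by linarith)
        rw [Real.exp_sub, Real.exp_log (by linarith), Real.exp_log (by linarith),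
          div_le_iff₀ (by linarith)] at he
        linarith
  have := hanti (Set.left_mem_Ico.2 one_pos) ha ha.1
  rwa [gaussPhiPair_zero] at this

/-- For small jumps the rescaled Gaussian tail is a subsolution up to a cubic error. -/
lemma le_gaussPhiPair {z : ℝ} (hz : 0 ≤ z) {a : ℝ} (ha : a ∈ Set.Icc (0 : ℝ) (1 / 2)) :
    2 * gaussPhi z - z ^ 2 * a ^ 3 ≤ gaussPhiPair z a := by
  have hsub : ∀ x ∈ Set.Icc (0 : ℝ) (1 / 2), x ∈ Set.Ico (0 : ℝ) 1 := fun x hx =>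
    ⟨hx.1, by linarith [hx.2]⟩
  have hd : ∀ x ∈ Set.Icc (0 : ℝ) (1 / 2), HasDerivAt
      (fun x => gaussPhiPair z x + z ^ 2 * x ^ 3) _ x := fun x hx =>
    (hasDerivAt_gaussPhiPair z (hsub x hx)).add ((hasDerivAt_pow 3 x).const_mul (z ^ 2))
  have hmono : MonotoneOn (fun x => gaussPhiPair z x + z ^ 2 * x ^ 3) (Set.Icc 0 (1 / 2)) := by
    apply monotoneOn_of_deriv_nonneg (convex_Icc 0 (1 / 2))
    · exact fun x hx => (hd x hx).continuousAt.continuousWithinAt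
    · exact fun x hx => (hd x (interior_subset hx)).differentiableAt.differentiableWithinAt
    · intro x hx
      have hx := interior_subset hx
      rw [(hd x hx).deriv]
      have hp := one_sub_sq_pos_of_mem (hsub x hx)
      have hx0 := hx.1
      have hs0 : 0 ≤ x * z := mul_nonneg hx.1 hz
      have key : -((x * z) ^ 2 / 2) ≤
          (1 - x * z) - (1 + x * z) * Real.exp (-(2 * (x * z) / (1 - x ^ 2))) := by
        have h1 : Real.exp (-(2 * (x * z) / (1 - x ^ 2))) ≤ Real.exp (-(2 * (x * z))) := by
          apply Real.exp_le_exp.2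
          have : 2 * (x * z) ≤ 2 * (x * z) / (1 - x ^ 2) := by
            rw [le_div_iff₀ hp]
            nlinarith [mul_nonneg hs0 (sq_nonneg x)]
          linarith
        have h2 : (1 + x * z) * Real.exp (-(2 * (x * z))) ≤ Real.exp (-(x * z)) := by
          have : Real.exp (-(x * z)) = Real.exp (x * z) * Real.exp (-(2 * (x * z))) := by
            rw [← Real.exp_add]
            congr 1
            ring
          rw [this]
          gcongr
          linarith [Real.add_one_le_exp (x * z)]
        have h3 : Real.exp (-(x * z)) ≤ 1 - x * z + (x * z) ^ 2 / 2 := by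
          have h4 := Real.quadratic_le_exp_of_nonneg hs0
          rw [Real.exp_neg]
          rw [inv_le_iff_one_le_mul₀ (Real.exp_pos _)]
          have h5 : 0 ≤ 1 - x * z + (x * z) ^ 2 / 2 := by nlinarith [sq_nonneg (x * z - 1)]
          nlinarith [mul_le_mul_of_nonneg_left h4 h5, sq_nonneg ((x * z) ^ 2)]
        have h6 := mul_le_mul_of_nonneg_left h1 (show 0 ≤ 1 + x * z by linarith)
        linarith
      have hs3 : 1 / 2 ≤ √(1 - x ^ 2) ^ 3 := by
        have h5 : (4 / 5 : ℝ) ≤ √(1 - x ^ 2) := by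
          apply Real.le_sqrt_of_sq_le
          nlinarith [hx.2]
        calc (1 / 2 : ℝ) ≤ (4 / 5) ^ 3 := by norm_num
          _ ≤ _ := by gcongr
      have hE : Real.exp (-((z - x) / √(1 - x ^ 2)) ^ 2 / 2) / √(1 - x ^ 2) ^ 3 ≤ 2 := by
        rw [div_le_iff₀ (by linarith)]
        have : Real.exp (-((z - x) / √(1 - x ^ 2)) ^ 2 / 2) ≤ 1 := by
          apply Real.exp_le_one_iff.2
          nlinarith [sq_nonneg ((z - x) / √(1 - x ^ 2))]
        linarith
      have hE0 : 0 ≤ Real.exp (-((z - x) / √(1 - x ^ 2)) ^ 2 / 2) / √(1 - x ^ 2) ^ 3 := by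
        positivity
      have h7 := mul_le_mul_of_nonneg_left key hE0
      have h8 := mul_le_mul_of_nonneg_right hE (show 0 ≤ (x * z) ^ 2 / 2 by positivity)
      norm_num
      nlinarith
  have := hmono (Set.left_mem_Icc.2 (by norm_num)) ha ha.1
  simp only [gaussPhiPair_zero] at this
  linarith

/-- `WalkProb t x p` says that `p` is the probability of ending at height at least `x` for some
finite walk with conditionally symmetric steps `±a` (where `a` may depend on the past) whose sum
of squared steps never exceeds `t`. -/
inductive WalkProb : ℝ → ℝ → ℝ → Prop
  | leaf_pos {t x : ℝ} (ht : 0 ≤ t) (hx : 0 < x) : WalkProb t x 0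
  | leaf_nonpos {t x : ℝ} (ht : 0 ≤ t) (hx : x ≤ 0) : WalkProb t x 1
  | node {t x p q : ℝ} (a : ℝ) (hp : WalkProb (t - a ^ 2) (x + a) p)
      (hq : WalkProb (t - a ^ 2) (x - a) q) : WalkProb t x ((p + q) / 2)

namespace WalkProb

lemma time_nonneg {t x p : ℝ} (h : WalkProb t x p) : 0 ≤ t := by
  induction h with
  | leaf_pos ht _ => exact ht
  | leaf_nonpos ht _ => exact ht
  | node a _ _ ih _ => nlinarith [sq_nonneg a]

lemma nonneg {t x p : ℝ} (h : WalkProb t x p) : 0 ≤ p := by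
  induction h with
  | leaf_pos => exact le_rfl
  | leaf_nonpos => exact zero_le_one
  | node _ _ _ ih₁ ih₂ => linarith

lemma le_one {t x p : ℝ} (h : WalkProb t x p) : p ≤ 1 := by
  induction h with
  | leaf_pos => exact zero_le_one
  | leaf_nonpos => exact le_rfl
  | node _ _ _ ih₁ ih₂ => linarith

lemma scale {t x p r : ℝ} (hr : 0 < r) (h : WalkProb t x p) :
    WalkProb (r ^ 2 * t) (r * x) p := by
  induction h with
  | leaf_pos ht hx => exact leaf_pos (by positivity) (by positivity)
  | leaf_nonpos ht hx => exact leaf_nonpos (by positivity) (mul_nonpos_of_nonneg_of_nonpos hr.le hx)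
  | node a _ _ ih₁ ih₂ =>
    refine node (r * a) ?_ ?_
    · convert ih₁ using 1 <;> ring
    · convert ih₂ using 1 <;> ring

lemma exists_of_le {t x p : ℝ} (h : WalkProb t x p) :
    ∀ {x' : ℝ}, x' ≤ x → ∃ p', p ≤ p' ∧ WalkProb t x' p' := by
  induction h with
  | leaf_pos ht hx =>
    intro x' _
    rcases le_or_gt x' 0 with h | h
    · exact ⟨1, zero_le_one, leaf_nonpos ht h⟩
    · exact ⟨0, le_rfl, leaf_pos ht h⟩
  | leaf_nonpos ht hx => exact fun h => ⟨1, le_rfl, leaf_nonpos ht (h.trans hx)⟩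
  | node a _ _ ih₁ ih₂ =>
    intro x' hx'
    obtain ⟨p₁, h₁, w₁⟩ := ih₁ (add_le_add_left hx' a)
    obtain ⟨p₂, h₂, w₂⟩ := ih₂ (sub_le_sub_right hx' a)
    exact ⟨_, by linarith, node a w₁ w₂⟩

end WalkProb

/-- The largest probability of ending at height at least `x` for walks with sum of squared steps
at most `1`. -/
def walkSup (x : ℝ) : ℝ := sSup {p | WalkProb 1 x p}

lemma WalkProb.le_walkSup_one {x p : ℝ} (h : WalkProb 1 x p) : p ≤ walkSup x :=
  le_csSup ⟨1, fun _ hq => WalkProb.le_one hq⟩ h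

lemma setOf_walkProb_nonempty (x : ℝ) : {p | WalkProb 1 x p}.Nonempty := by
  rcases le_or_gt x 0 with h | h
  · exact ⟨1, .leaf_nonpos zero_le_one h⟩
  · exact ⟨0, .leaf_pos zero_le_one h⟩

lemma walkSup_nonneg (x : ℝ) : 0 ≤ walkSup x := by
  obtain ⟨p, hp⟩ := setOf_walkProb_nonempty x
  exact hp.nonneg.trans hp.le_walkSup_one

lemma walkSup_antitone : Antitone walkSup := fun _ y hxy =>
  csSup_le (setOf_walkProb_nonempty y) fun _ hp =>
    let ⟨_, hle, hw⟩ := WalkProb.exists_of_le hp hxy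
    hle.trans hw.le_walkSup_one

lemma walkSup_zero : 1 ≤ walkSup 0 :=
  (WalkProb.leaf_nonpos zero_le_one le_rfl).le_walkSup_one

lemma WalkProb.le_walkSup {t x p : ℝ} (ht : 0 < t) (h : WalkProb t x p) :
    p ≤ walkSup (x / √t) := by
  have hs : 0 < √t := Real.sqrt_pos.2 ht
  have h1 := h.scale (inv_pos.2 hs)
  rw [inv_pow, Real.sq_sqrt ht.le, inv_mul_cancel₀ ht.ne', inv_mul_eq_div] at h1
  exact h1.le_walkSup_one

lemma WalkProb.of_one {t x p : ℝ} (ht : 0 < t) (h : WalkProb 1 (x / √t) p) : WalkProb t x p := by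
  have hs : 0 < √t := Real.sqrt_pos.2 ht
  have h1 := h.scale hs
  rwa [Real.sq_sqrt ht.le, mul_one, mul_div_cancel₀ _ hs.ne'] at h1

/-- The main inequality for the largest walk probability. -/
lemma walkSup_add_walkSup_le (x : ℝ) {a : ℝ} (ha : a ∈ Set.Ico (0 : ℝ) 1) :
    walkSup ((x - a) / √(1 - a ^ 2)) + walkSup ((x + a) / √(1 - a ^ 2)) ≤ 2 * walkSup x := by
  have hp := one_sub_sq_pos_of_mem ha
  rw [← le_sub_iff_add_le]
  refine csSup_le (setOf_walkProb_nonempty _) fun p hpm => ?_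
  rw [le_sub_iff_add_le, ← le_sub_iff_add_le']
  refine csSup_le (setOf_walkProb_nonempty _) fun q hqm => ?_
  have := (WalkProb.node a (WalkProb.of_one hp hqm) (WalkProb.of_one hp hpm)).le_walkSup_one
  linarith

/-- A strict subsolution of the main inequality that lies below `walkSup` to the left of `y` and
to the right of `M` lies below it on `[y, M]`. -/
lemma le_walkSup_of_strict_subsolution {ψ : ℝ → ℝ} {y M δ κ B : ℝ} (hδ : δ ∈ Set.Ico (0 : ℝ) 1)
    (hκ : 0 < κ) (hB : ∀ z ∈ Set.Icc y M, ψ z ≤ B)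
    (hsub : ∀ z ∈ Set.Icc y M,
      2 * ψ z + 2 * κ ≤ ψ ((z - δ) / √(1 - δ ^ 2)) + ψ ((z + δ) / √(1 - δ ^ 2)))
    (hout : ∀ z ∈ Set.Icc y M, ∀ w, w = (z - δ) / √(1 - δ ^ 2) ∨ w = (z + δ) / √(1 - δ ^ 2) →
      w ∉ Set.Icc y M → ψ w ≤ walkSup w) :
    ∀ z ∈ Set.Icc y M, ψ z ≤ walkSup z := by
  have key : ∀ n : ℕ, ∀ z ∈ Set.Icc y M, ψ z - walkSup z ≤ max 0 (B - n * κ) := by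
    intro n
    induction n with
    | zero =>
      intro z hz
      refine le_max_of_le_right ?_
      have := hB z hz
      have := walkSup_nonneg z
      simp
      linarith
    | succ n ih =>
      intro z hz
      have hw : ∀ w, w = (z - δ) / √(1 - δ ^ 2) ∨ w = (z + δ) / √(1 - δ ^ 2) →
          ψ w - walkSup w ≤ max 0 (B - n * κ) := by
        intro w hw
        by_cases hwm : w ∈ Set.Icc y M
        · exact ih w hwm
        · exact le_max_of_le_left (sub_nonpos.2 (hout z hz w hw hwm))
      have h1 := hw _ (Or.inl rfl)
      have h2 := hw _ (Or.inr rfl)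
      have h3 := hsub z hz
      have h4 := walkSup_add_walkSup_le z hδ
      have h5 : max 0 (B - n * κ) - κ ≤ max 0 (B - (n + 1 : ℕ) * κ) := by
        rw [sub_le_iff_le_add]
        apply max_le
        · have := le_max_left 0 (B - (n + 1 : ℕ) * κ)
          linarith
        · have := le_max_right 0 (B - (n + 1 : ℕ) * κ)
          push_cast at this ⊢
          linarith
      linarith
  intro z hz
  obtain ⟨n, hn⟩ := exists_nat_gt (B / κ)
  rw [div_lt_iff₀ hκ] at hn
  have := key n z hz
  rw [max_eq_left (by linarith)] at this
  linarith

lemma eventually_gaussPhi_jump_bounds {y M ε : ℝ} (hε : 0 < ε) :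
    ∀ᶠ δ in nhdsWithin (0 : ℝ) (Set.Ioi 0), 0 < δ ∧ δ < 1 / 4 ∧ (M + 2) * δ ≤ 1 ∧
      M ^ 2 * (M + 2) ^ 2 * δ < ε ∧ gaussPhi (y - 3 * δ) < gaussPhi y + ε := by
  refine eventually_nhdsWithin_iff.2 ?_
  have h1 : ∀ᶠ δ in nhds (0 : ℝ), δ < 1 / 4 := eventually_lt_nhds (by norm_num)
  have h2 : ∀ᶠ δ in nhds (0 : ℝ), (M + 2) * δ < 1 := by
    have hc : Continuous fun δ : ℝ => (M + 2) * δ := by fun_prop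
    exact hc.continuousAt.eventually_lt_const (by simp)
  have h3 : ∀ᶠ δ in nhds (0 : ℝ), M ^ 2 * (M + 2) ^ 2 * δ < ε := by
    have hc : Continuous fun δ : ℝ => M ^ 2 * (M + 2) ^ 2 * δ := by fun_prop
    exact hc.continuousAt.eventually_lt_const (by simpa)
  have h4 : ∀ᶠ δ in nhds (0 : ℝ), gaussPhi (y - 3 * δ) < gaussPhi y + ε := by
    have hc : Continuous fun δ : ℝ => gaussPhi (y - 3 * δ) :=
      continuous_gaussPhi.comp (by fun_prop)
    exact hc.continuousAt.eventually_lt_const (by simpa)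
  filter_upwards [h1, h2, h3, h4] with δ a1 a2 a3 a4 hδ
  exact ⟨hδ, a1, a2.le, a3, a4⟩

/-- `walkSup / gaussPhi` is nondecreasing on `[0, ∞)`. -/
lemma walkSup_mul_gaussPhi_le {x y : ℝ} (hy : 0 ≤ y) (hxy : y ≤ x) :
    walkSup y * gaussPhi x ≤ walkSup x * gaussPhi y := by
  rcases (walkSup_nonneg y).eq_or_lt with h0 | hwy
  · rw [← h0, zero_mul]
    exact mul_nonneg (walkSup_nonneg x) (gaussPhi_nonneg y)
  have hΦy := gaussPhi_pos y
  set K := walkSup y / gaussPhi y with hK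
  have hKpos : 0 < K := div_pos hwy hΦy
  have hKy : K * gaussPhi y = walkSup y := div_mul_cancel₀ _ hΦy.ne'
  suffices h : ∀ ε > 0, K * (gaussPhi x - 2 * ε) ≤ walkSup x by
    have h1 : K * gaussPhi x ≤ walkSup x := by
      refine le_of_forall_pos_le_add fun ε hε => ?_
      have h2 := h (ε / (2 * K)) (by positivity)
      have h3 : K * (gaussPhi x - 2 * (ε / (2 * K))) = K * gaussPhi x - ε := by
        field_simp
      linarith
    have h4 := mul_le_mul_of_nonneg_right h1 hΦy.le
    rw [← hKy]
    linarith
  intro ε hε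
  obtain ⟨M, hMx, hMΦ⟩ : ∃ M, x ≤ M ∧ gaussPhi M < ε :=
    ((Filter.eventually_ge_atTop x).and
      (tendsto_gaussPhi_atTop.eventually_lt_const hε)).exists
  have hM0 : 0 ≤ M := hy.trans (hxy.trans hMx)
  obtain ⟨δ, hδ0, hδ1, hδM, hδε, hδΦ⟩ :=
    (eventually_gaussPhi_jump_bounds (y := y) (M := M) hε).exists
  have hδ : δ ∈ Set.Ico (0 : ℝ) 1 := ⟨hδ0.le, by linarith⟩
  have hsp := one_sub_sq_pos_of_mem hδ
  have hs0 : 0 < √(1 - δ ^ 2) := Real.sqrt_pos.2 hsp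
  have hsq : √(1 - δ ^ 2) ^ 2 = 1 - δ ^ 2 := Real.sq_sqrt hsp.le
  have hs1 : √(1 - δ ^ 2) ≤ 1 := Real.sqrt_le_one.2 (by nlinarith)
  have hslb : 1 - δ ^ 2 ≤ √(1 - δ ^ 2) := by nlinarith
  have hN : 0 < (M + 2) ^ 2 := by positivity
  set ψ : ℝ → ℝ := fun z => gaussPhi z - ε * (2 - z ^ 2 / (M + 2) ^ 2) with hψ
  have hη : ∀ w, -(M + 2) ≤ w → w ≤ M + 2 → ε ≤ ε * (2 - w ^ 2 / (M + 2) ^ 2) := by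
    intro w hw1 hw2
    have : w ^ 2 / (M + 2) ^ 2 ≤ 1 := by
      rw [div_le_one hN]
      exact sq_le_sq' hw1 hw2
    nlinarith
  have hmain := le_walkSup_of_strict_subsolution (ψ := fun z => K * ψ z) (y := y) (M := M)
    (δ := δ) (κ := K * (ε * δ ^ 2 / (2 * (M + 2) ^ 2))) (B := K * gaussPhi 0) hδ (by positivity)
    ?_ ?_ ?_ x ⟨hxy, hMx⟩
  · refine le_trans ?_ hmain
    apply mul_le_mul_of_nonneg_left _ hKpos.le
    have : 0 ≤ ε * (x ^ 2 / (M + 2) ^ 2) := by positivity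
    simp only [hψ]
    linarith
  · intro z hz
    apply mul_le_mul_of_nonneg_left _ hKpos.le
    have h1 := hη z (by linarith [hz.1]) (by linarith [hz.2])
    have h2 := gaussPhi_strictAnti.antitone (hy.trans hz.1)
    simp only [hψ]
    linarith
  · intro z hz
    have hz0 : 0 ≤ z := hy.trans hz.1
    have h1 := le_gaussPhiPair hz0 (a := δ) ⟨hδ0.le, by linarith⟩
    have h2 : z ^ 2 * δ ^ 3 ≤ ε * δ ^ 2 / (M + 2) ^ 2 := by
      rw [le_div_iff₀ hN]
      have h3 : z ^ 2 ≤ M ^ 2 := pow_le_pow_left₀ hz0 hz.2 2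
      calc z ^ 2 * δ ^ 3 * (M + 2) ^ 2 ≤ M ^ 2 * δ ^ 3 * (M + 2) ^ 2 := by gcongr
        _ = (M ^ 2 * (M + 2) ^ 2 * δ) * δ ^ 2 := by ring
        _ ≤ ε * δ ^ 2 := by gcongr
    have h3 : ((z - δ) / √(1 - δ ^ 2)) ^ 2 + ((z + δ) / √(1 - δ ^ 2)) ^ 2 ≥
        2 * z ^ 2 + 2 * δ ^ 2 := by
      rw [div_pow, div_pow, hsq, ← add_div, ge_iff_le, le_div_iff₀ hsp]
      nlinarith [mul_nonneg (sq_nonneg z) (sq_nonneg δ), mul_nonneg (sq_nonneg δ) (sq_nonneg δ)]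
    have h4 : ε * ((2 * z ^ 2 + 2 * δ ^ 2) / (M + 2) ^ 2) ≤
        ε * ((((z - δ) / √(1 - δ ^ 2)) ^ 2 + ((z + δ) / √(1 - δ ^ 2)) ^ 2) / (M + 2) ^ 2) := by
      gcongr
    unfold gaussPhiPair at h1
    simp only [hψ]
    have h5 : 2 * (K * (ε * δ ^ 2 / (2 * (M + 2) ^ 2))) = K * (ε * δ ^ 2 / (M + 2) ^ 2) := by
      field_simp
    rw [h5, ← mul_add, mul_left_comm, ← mul_add]
    apply mul_le_mul_of_nonneg_left _ hKpos.le
    have h6 : ε * ((2 * z ^ 2 + 2 * δ ^ 2) / (M + 2) ^ 2) =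
        2 * (ε * (z ^ 2 / (M + 2) ^ 2)) + 2 * (ε * δ ^ 2 / (M + 2) ^ 2) := by ring
    rw [h6, add_div, mul_add] at h4
    linarith
  · intro z hz w hw hwm
    have hz0 : 0 ≤ z := hy.trans hz.1
    have hup : (z + δ) / √(1 - δ ^ 2) ≤ M + 2 := by
      rw [div_le_iff₀ hs0]
      have := hz.2
      nlinarith [mul_le_mul_of_nonneg_left hslb (show 0 ≤ M + 2 by linarith)]
    have hlow : y - 3 * δ ≤ (z - δ) / √(1 - δ ^ 2) := by
      rw [le_div_iff₀ hs0]
      have := hz.1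
      rcases le_or_gt 0 (y - 3 * δ) with h | h
      · nlinarith
      · nlinarith
    have hle : (z - δ) / √(1 - δ ^ 2) ≤ (z + δ) / √(1 - δ ^ 2) := by
      gcongr
      linarith
    have hwl : y - 3 * δ ≤ w := by rcases hw with rfl | rfl <;> linarith
    have hwu : w ≤ M + 2 := by rcases hw with rfl | rfl <;> linarith
    have hη' := hη w (by linarith) hwu
    rcases lt_or_ge w y with h | h
    · have h1 := gaussPhi_strictAnti.antitone hwl
      have h2 : K * ψ w ≤ K * gaussPhi y := by
        apply mul_le_mul_of_nonneg_left _ hKpos.le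
        simp only [hψ]
        linarith
      rw [hKy] at h2
      exact h2.trans (walkSup_antitone h.le)
    · have h1 : M < w := by
        by_contra hcon
        exact hwm ⟨h, not_lt.1 hcon⟩
      have h2 := gaussPhi_strictAnti.antitone h1.le
      have h3 : K * ψ w ≤ K * 0 := by
        apply mul_le_mul_of_nonneg_left _ hKpos.le
        simp only [hψ]
        linarith
      rw [mul_zero] at h3
      exact h3.trans (walkSup_nonneg w)

lemma WalkProb.le_const_mul_gaussPhi {t x p : ℝ} (h : WalkProb t x p) (hx : 0 < x) :
    (t = 0 → p = 0) ∧ (0 < t → p ≤ walkSup √3 / gaussPhi √3 * gaussPhi (x / √t)) := by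
  have hc : 0 ≤ walkSup √3 / gaussPhi √3 := div_nonneg (walkSup_nonneg _) (gaussPhi_nonneg _)
  induction h with
  | leaf_pos ht _ => exact ⟨fun _ => rfl, fun _ => mul_nonneg hc (gaussPhi_nonneg _)⟩
  | leaf_nonpos _ h => exact absurd hx h.not_gt
  | @node t x p q a hp hq ihp ihq =>
    have hta := hp.time_nonneg
    constructor
    · rintro rfl
      have ha : a = 0 := by nlinarith [sq_nonneg a]
      subst ha
      simp [(ihp (by simpa)).1 (by simp), (ihq (by simpa)).1 (by simp)]
    · intro ht
      have hst : 0 < √t := Real.sqrt_pos.2 ht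
      rcases lt_or_ge (x / √t) √3 with hlt | hge
      · refine ((WalkProb.node a hp hq).le_walkSup ht).trans ?_
        rw [div_mul_eq_mul_div, le_div_iff₀ (gaussPhi_pos _)]
        exact walkSup_mul_gaussPhi_le (by positivity) hlt.le
      · have hsq : √t ^ 2 = t := Real.sq_sqrt ht.le
        have hat : |a| ≤ √t := Real.abs_le_sqrt (by linarith)
        have hxt : √t < x := by
          have hge := (le_div_iff₀ hst).1 hge
          have : 1 < √3 := by
            rw [Real.lt_sqrt zero_le_one]
            norm_num
          nlinarith
        obtain ⟨ha1, ha2⟩ := abs_le.1 hat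
        have ihp := ihp (by linarith)
        have ihq := ihq (by linarith)
        rcases hta.eq_or_lt with h0 | hpos
        · rw [ihp.1 h0.symm, ihq.1 h0.symm]
          simpa using mul_nonneg hc (gaussPhi_nonneg _)
        · have h1 := ihp.2 hpos
          have h2 := ihq.2 hpos
          have hu : |a / √t| ∈ Set.Ico (0 : ℝ) 1 := by
            refine ⟨abs_nonneg _, ?_⟩
            rw [abs_div, abs_of_pos hst, div_lt_one hst]
            exact Real.lt_sqrt (abs_nonneg a) |>.2 (by rw [sq_abs]; linarith)
          have h3 := gaussPhiPair_le hge hu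
          have h4 : gaussPhiPair (x / √t) |a / √t| = gaussPhiPair (x / √t) (a / √t) := by
            rcases abs_choice (a / √t) with h | h <;> rw [h]
            rw [gaussPhiPair_neg]
          have h5 : √(1 - (a / √t) ^ 2) = √(t - a ^ 2) / √t := by
            rw [← Real.sqrt_div hta, div_pow, hsq, sub_div, div_self ht.ne']
          rw [h4, gaussPhiPair, h5, ← sub_div, ← add_div, div_div_div_cancel_right₀ hst.ne',
            div_div_div_cancel_right₀ hst.ne'] at h3
          have h6 := mul_le_mul_of_nonneg_left h3 hc
          linarith

lemma walkSup_eq_const_mul_gaussPhi {x : ℝ} (hx : √3 ≤ x) :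
    walkSup x = walkSup √3 / gaussPhi √3 * gaussPhi x := by
  have h3 : (0 : ℝ) < √3 := by positivity
  apply le_antisymm
  · refine csSup_le (setOf_walkProb_nonempty x) fun p hp => ?_
    simpa using (WalkProb.le_const_mul_gaussPhi hp (h3.trans_le hx)).2 one_pos
  · rw [div_mul_eq_mul_div, div_le_iff₀ (gaussPhi_pos _)]
    exact walkSup_mul_gaussPhi_le h3.le hx

lemma walkSup_pos {x : ℝ} (hx : 0 ≤ x) : 0 < walkSup x := by
  have h := walkSup_mul_gaussPhi_le le_rfl hx
  have h1 := mul_le_mul_of_nonneg_right walkSup_zero (gaussPhi_nonneg x)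
  have h2 := gaussPhi_pos x
  exact pos_of_mul_pos_left (by linarith) (gaussPhi_nonneg 0)

/-- Left semicontinuity of `walkSup` from the monotonicity of its ratio to `gaussPhi`. -/
lemma le_walkSup_of_forall_lt {x m : ℝ} (hx : 0 < x) (h : ∀ y < x, m ≤ walkSup y) :
    m ≤ walkSup x := by
  have hlim : Filter.Tendsto (fun y => walkSup x * gaussPhi y) (nhdsWithin x (Set.Iio x))
      (nhds (walkSup x * gaussPhi x)) :=
    ((continuous_gaussPhi.tendsto x).mono_left nhdsWithin_le_nhds).const_mul _
  have hev : ∀ᶠ y in nhdsWithin x (Set.Iio x), m * gaussPhi x ≤ walkSup x * gaussPhi y := by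
    filter_upwards [Ioo_mem_nhdsLT hx] with y hy
    exact (mul_le_mul_of_nonneg_right (h y hy.2) (gaussPhi_nonneg x)).trans
      (walkSup_mul_gaussPhi_le hy.1.le hy.2.le)
  exact le_of_mul_le_mul_right (ge_of_tendsto hlim hev) (gaussPhi_pos x)

/-- The half-open dyadic interval `[k/2^n, (k+1)/2^n)`. -/
def dyadicIco (n k : ℕ) : Set ℝ := Set.Ico ((k : ℝ) / 2 ^ n) (((k : ℝ) + 1) / 2 ^ n)

/-- The index of the dyadic interval of length `2^{-n}` containing `y`. -/
def dyadicIdx (n : ℕ) (y : ℝ) : ℕ := ⌊2 ^ n * y⌋₊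

/-- The average of `f` over `[k/2^n, (k+1)/2^n)`. -/
def dyadicAvg (f : ℝ → ℝ) (n k : ℕ) : ℝ := 2 ^ n * ∫ y in dyadicIco n k, f y

lemma measurableSet_dyadicIco (n k : ℕ) : MeasurableSet (dyadicIco n k) := measurableSet_Ico

lemma dyadic_left_le_right (n k : ℕ) : (k : ℝ) / 2 ^ n ≤ ((k : ℝ) + 1) / 2 ^ n := by
  gcongr
  linarith

lemma nonneg_of_mem_dyadicIco {n k : ℕ} {y : ℝ} (hy : y ∈ dyadicIco n k) : 0 ≤ y :=
  le_trans (by positivity) hy.1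

lemma mem_dyadicIco_iff {n k : ℕ} {y : ℝ} (hy : 0 ≤ y) :
    y ∈ dyadicIco n k ↔ dyadicIdx n y = k := by
  have h2 : (0 : ℝ) < 2 ^ n := by positivity
  rw [dyadicIdx, Nat.floor_eq_iff (by positivity), dyadicIco, Set.mem_Ico, div_le_iff₀' h2,
    lt_div_iff₀' h2]

lemma dyadicIdx_of_mem {n k : ℕ} {y : ℝ} (hy : y ∈ dyadicIco n k) : dyadicIdx n y = k :=
  (mem_dyadicIco_iff (nonneg_of_mem_dyadicIco hy)).1 hy

lemma mem_dyadicIco_dyadicIdx (n : ℕ) {y : ℝ} (hy : 0 ≤ y) : y ∈ dyadicIco n (dyadicIdx n y) :=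
  (mem_dyadicIco_iff hy).2 rfl

lemma dyadicIdx_succ_div_two (n : ℕ) (y : ℝ) : dyadicIdx (n + 1) y / 2 = dyadicIdx n y := by
  have h := Nat.floor_div_natCast ((2 : ℝ) ^ (n + 1) * y) 2
  rw [dyadicIdx, dyadicIdx, ← h]
  congr 1
  push_cast
  ring

lemma dyadicIdx_lt (n : ℕ) {y : ℝ} (hy : y ∈ Set.Ico (0 : ℝ) 1) : dyadicIdx n y < 2 ^ n := by
  have h2 : (0 : ℝ) < 2 ^ n := by positivity
  rw [dyadicIdx, Nat.floor_lt (mul_nonneg h2.le hy.1)]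
  push_cast
  nlinarith [hy.2]

lemma dyadicIco_zero : dyadicIco 0 0 = Set.Ico 0 1 := by simp [dyadicIco]

lemma dyadicIco_subset {n k : ℕ} (hk : k < 2 ^ n) : dyadicIco n k ⊆ Set.Ico 0 1 := by
  have h2 : (0 : ℝ) < 2 ^ n := by positivity
  apply Set.Ico_subset_Ico (by positivity)
  rw [div_le_one h2]
  exact_mod_cast hk

lemma dyadicIco_subset_Icc {n k : ℕ} (hk : k < 2 ^ n) : dyadicIco n k ⊆ Set.Icc 0 1 :=
  (dyadicIco_subset hk).trans Set.Ico_subset_Icc_self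

lemma dyadicIco_two_mul (n k : ℕ) :
    dyadicIco (n + 1) (2 * k) = Set.Ico ((k : ℝ) / 2 ^ n) ((2 * (k : ℝ) + 1) / 2 ^ (n + 1)) := by
  rw [dyadicIco]
  congr 1
  · push_cast
    rw [pow_succ]
    field_simp
  · push_cast
    rfl

lemma dyadicIco_two_mul_add_one (n k : ℕ) : dyadicIco (n + 1) (2 * k + 1) =
    Set.Ico ((2 * (k : ℝ) + 1) / 2 ^ (n + 1)) (((k : ℝ) + 1) / 2 ^ n) := by
  rw [dyadicIco]
  congr 1
  · push_cast
    ring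
  · push_cast
    rw [pow_succ]
    field_simp
    ring

lemma dyadicIco_split (n k : ℕ) :
    dyadicIco n k = dyadicIco (n + 1) (2 * k) ∪ dyadicIco (n + 1) (2 * k + 1) := by
  have h2 : (0 : ℝ) < 2 ^ n := by positivity
  rw [dyadicIco_two_mul, dyadicIco_two_mul_add_one, dyadicIco, Set.Ico_union_Ico_eq_Ico]
  · rw [pow_succ, div_le_div_iff₀ h2 (by positivity)]
    nlinarith
  · rw [pow_succ, div_le_div_iff₀ (by positivity) h2]
    nlinarith

lemma disjoint_dyadicIco (n k : ℕ) :
    Disjoint (dyadicIco (n + 1) (2 * k)) (dyadicIco (n + 1) (2 * k + 1)) := by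
  rw [dyadicIco_two_mul, dyadicIco_two_mul_add_one]
  exact Set.Ico_disjoint_Ico_same

lemma volume_dyadicIco (n k : ℕ) : volume (dyadicIco n k) = ENNReal.ofReal (1 / 2 ^ n) := by
  rw [dyadicIco, Real.volume_Ico]
  congr 1
  ring

lemma dyadicAvg_zero (f : ℝ → ℝ) : dyadicAvg f 0 0 = ∫ y in Set.Icc (0 : ℝ) 1, f y := by
  rw [dyadicAvg, dyadicIco_zero, integral_Icc_eq_integral_Ico, pow_zero, one_mul]

lemma dyadicAvg_eq_intervalIntegral (f : ℝ → ℝ) (n k : ℕ) :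
    dyadicAvg f n k = 2 ^ n * ∫ y in ((k : ℝ) / 2 ^ n)..(((k : ℝ) + 1) / 2 ^ n), f y := by
  rw [dyadicAvg, intervalIntegral.integral_of_le (dyadic_left_le_right n k),
    ← integral_Ico_eq_integral_Ioc, dyadicIco]

section Coefficients

variable {f : ℝ → ℝ} {n k : ℕ}

lemma dyadicAvg_split (hf : IntegrableOn f (Set.Icc 0 1)) (hk : k < 2 ^ n) :
    dyadicAvg f n k = (dyadicAvg f (n + 1) (2 * k) + dyadicAvg f (n + 1) (2 * k + 1)) / 2 := by
  have h := hf.mono_set (dyadicIco_subset_Icc hk)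
  rw [dyadicIco_split] at h
  rw [dyadicAvg, dyadicIco_split, setIntegral_union (disjoint_dyadicIco n k)
    (measurableSet_dyadicIco _ _) h.left_of_union h.right_of_union, dyadicAvg, dyadicAvg]
  ring

lemma haar_eq_indicator_sub (n k : ℕ) (y : ℝ) : haar n k y =
    (dyadicIco (n + 1) (2 * k + 1)).indicator 1 y - (dyadicIco (n + 1) (2 * k)).indicator 1 y := by
  have hd : y ∈ dyadicIco (n + 1) (2 * k) → y ∉ dyadicIco (n + 1) (2 * k + 1) :=
    fun h => Set.disjoint_left.1 (disjoint_dyadicIco n k) h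
  rw [dyadicIco_two_mul, dyadicIco_two_mul_add_one] at *
  rw [haar]
  split_ifs with h1 h2
  · simp [Set.indicator_of_mem h1, Set.indicator_of_notMem (hd h1)]
  · simp [Set.indicator_of_mem h2, Set.indicator_of_notMem h1]
  · simp [Set.indicator_of_notMem h2, Set.indicator_of_notMem h1]

lemma haarCoeff_eq (hf : IntegrableOn f (Set.Icc 0 1)) (hk : k < 2 ^ n) :
    haarCoeff f n k = (dyadicAvg f (n + 1) (2 * k + 1) - dyadicAvg f (n + 1) (2 * k)) / 2 := by
  have hk0 : 2 * k < 2 ^ (n + 1) := by rw [pow_succ]; omega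
  have hk1 : 2 * k + 1 < 2 ^ (n + 1) := by rw [pow_succ]; omega
  have h : ∀ y, f y * haar n k y = (dyadicIco (n + 1) (2 * k + 1)).indicator f y -
      (dyadicIco (n + 1) (2 * k)).indicator f y := by
    intro y
    rw [haar_eq_indicator_sub, mul_sub]
    congr 1 <;> rw [← Set.indicator_mul_right (g := 1)] <;> simp
  rw [haarCoeff]
  simp_rw [h]
  rw [integral_sub (hf.indicator (measurableSet_dyadicIco _ _))
    (hf.indicator (measurableSet_dyadicIco _ _)), setIntegral_indicator
    (measurableSet_dyadicIco _ _), setIntegral_indicator (measurableSet_dyadicIco _ _),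
    Set.inter_eq_self_of_subset_right (dyadicIco_subset_Icc hk0),
    Set.inter_eq_self_of_subset_right (dyadicIco_subset_Icc hk1), dyadicAvg, dyadicAvg]
  ring

lemma dyadicAvg_two_mul (hf : IntegrableOn f (Set.Icc 0 1)) (hk : k < 2 ^ n) :
    dyadicAvg f (n + 1) (2 * k) = dyadicAvg f n k - haarCoeff f n k := by
  rw [dyadicAvg_split hf hk, haarCoeff_eq hf hk]
  ring

lemma dyadicAvg_two_mul_add_one (hf : IntegrableOn f (Set.Icc 0 1)) (hk : k < 2 ^ n) :
    dyadicAvg f (n + 1) (2 * k + 1) = dyadicAvg f n k + haarCoeff f n k := by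
  rw [dyadicAvg_split hf hk, haarCoeff_eq hf hk]
  ring

end Coefficients

/-- The sum of the squared Haar coefficients of `f` over the proper dyadic ancestors of
`[k/2^n, (k+1)/2^n]`. -/
def ancestorSq (f : ℝ → ℝ) : ℕ → ℕ → ℝ
  | 0, _ => 0
  | n + 1, k => ancestorSq f n (k / 2) + haarCoeff f n (k / 2) ^ 2

lemma ancestorSq_dyadicIdx (f : ℝ → ℝ) (n : ℕ) (y : ℝ) :
    ancestorSq f n (dyadicIdx n y) =
      ∑ m ∈ Finset.range n, haarCoeff f m (dyadicIdx m y) ^ 2 := by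
  induction n with
  | zero => simp [ancestorSq]
  | succ n ih => rw [ancestorSq, dyadicIdx_succ_div_two, ih, Finset.sum_range_succ]

/-- Integrable functions of mean zero all of whose partial square functions have square at
most `t` everywhere. -/
structure SqBounded (t : ℝ) (f : ℝ → ℝ) : Prop where
  integrableOn : IntegrableOn f (Set.Icc 0 1)
  integral_eq_zero : ∫ y in Set.Icc (0 : ℝ) 1, f y = 0
  ancestorSq_le : ∀ n k, k < 2 ^ n → ancestorSq f n k ≤ t

lemma ae_ne_dyadic : ∀ᵐ y : ℝ, ∀ n k : ℕ, y ≠ (k : ℝ) / 2 ^ n := by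
  have hc : (Set.range fun p : ℕ × ℕ => (p.2 : ℝ) / 2 ^ p.1).Countable := Set.countable_range _
  filter_upwards [hc.ae_notMem volume] with y hy n k h
  exact hy ⟨(n, k), h.symm⟩

lemma sqFn_eq_sqrt_tsum (f : ℝ → ℝ) {y : ℝ} (hy : 0 ≤ y) (hd : ∀ n k : ℕ, y ≠ (k : ℝ) / 2 ^ n) :
    sqFn f y = √(∑' n, haarCoeff f n (dyadicIdx n y) ^ 2) := by
  have hmem : ∀ n k, y ∈ dyadicI n k ↔ dyadicIdx n y = k := by
    intro n k
    rw [← mem_dyadicIco_iff hy, dyadicI, dyadicIco, Set.mem_Icc, Set.mem_Ico]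
    refine and_congr_right fun _ => ⟨fun h => lt_of_le_of_ne h ?_, le_of_lt⟩
    exact_mod_cast hd n (k + 1)
  have hinj : Function.Injective fun n : ℕ => (n, dyadicIdx n y) :=
    fun a b h => (Prod.ext_iff.1 h).1
  rw [sqFn, ← hinj.tsum_eq]
  · congr 1
    refine tsum_congr fun n => ?_
    simp [Set.indicator_of_mem ((hmem n _).2 rfl)]
  · rintro ⟨n, k⟩ hp
    refine ⟨n, ?_⟩
    have : y ∈ dyadicI n k := by
      by_contra h
      exact hp (by simp [Set.indicator_of_notMem h])
    simp [(hmem n k).1 this]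

lemma ae_restrict_Icc_mem_Ico :
    ∀ᵐ y ∂(volume.restrict (Set.Icc (0 : ℝ) 1)), y ∈ Set.Ico (0 : ℝ) 1 := by
  rw [← restrict_Ico_eq_restrict_Icc]
  exact ae_restrict_mem measurableSet_Ico

lemma SqBounded.admissible {f : ℝ → ℝ} (h : SqBounded 1 f) : Admissible f := by
  refine ⟨h.integrableOn, h.integral_eq_zero, ?_⟩
  filter_upwards [ae_restrict_Icc_mem_Ico, ae_restrict_of_ae ae_ne_dyadic] with y hy hd
  rw [sqFn_eq_sqrt_tsum f hy.1 hd, Real.sqrt_le_one]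
  refine Real.tsum_le_of_sum_range_le (fun _ => sq_nonneg _) fun n => ?_
  rw [← ancestorSq_dyadicIdx]
  exact h.ancestorSq_le n _ (dyadicIdx_lt n hy)

lemma lintegral_dyadicIco_split (g : ℝ → ENNReal) (n k : ℕ) :
    ∫⁻ y in dyadicIco n k, g y =
      (∫⁻ y in dyadicIco (n + 1) (2 * k), g y) + ∫⁻ y in dyadicIco (n + 1) (2 * k + 1), g y := by
  rw [dyadicIco_split, lintegral_union (measurableSet_dyadicIco _ _) (disjoint_dyadicIco n k)]

/-- The dyadic intervals on both of whose halves the averages of `f` are at most `r`. -/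
def BoundedHalves (f : ℝ → ℝ) (r : ℝ) (n k : ℕ) : Prop :=
  |dyadicAvg f (n + 1) (2 * k)| ≤ r ∧ |dyadicAvg f (n + 1) (2 * k + 1)| ≤ r

open Classical in
/-- The sum over at most `N` generations, starting from generation `n`, of the squared Haar
coefficients of the dyadic intervals containing `y`, stopped at the first interval where
`BoundedHalves` fails. -/
def stoppedSq (f : ℝ → ℝ) (r : ℝ) : ℕ → ℕ → ℝ → ENNReal
  | 0, _, _ => 0
  | N + 1, n, y => if BoundedHalves f r n (dyadicIdx n y) then
      ENNReal.ofReal (haarCoeff f n (dyadicIdx n y) ^ 2) + stoppedSq f r N (n + 1) y else 0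

section StoppedSq

variable {f : ℝ → ℝ} {r : ℝ}

lemma measurable_dyadicIdx (n : ℕ) : Measurable (dyadicIdx n) :=
  Nat.measurable_floor.comp (measurable_const_mul _)

lemma measurable_stoppedSq (N : ℕ) : ∀ n, Measurable (stoppedSq f r N n) := by
  classical
  induction N with
  | zero => exact fun n => measurable_const
  | succ N ih =>
    intro n
    refine Measurable.ite ?_ ?_ measurable_const
    · exact measurable_dyadicIdx n (MeasurableSet.of_discrete (s := {k | BoundedHalves f r n k}))
    · exact ((measurable_of_countable fun k => ENNReal.ofReal (haarCoeff f n k ^ 2)).comp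
        (measurable_dyadicIdx n)).add (ih (n + 1))

lemma stoppedSq_le_succ (N : ℕ) : ∀ n y, stoppedSq f r N n y ≤ stoppedSq f r (N + 1) n y := by
  induction N with
  | zero => exact fun n y => zero_le
  | succ N ih =>
    intro n y
    rw [stoppedSq, stoppedSq]
    split_ifs
    · gcongr
      exact ih _ _
    · exact le_rfl

/-- The energy inequality for the stopped square function. -/
lemma lintegral_stoppedSq_le (hf : IntegrableOn f (Set.Icc 0 1)) (N : ℕ) :
    ∀ n k, k < 2 ^ n → |dyadicAvg f n k| ≤ r →
      ∫⁻ y in dyadicIco n k, stoppedSq f r N n y ≤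
        ENNReal.ofReal ((r ^ 2 - dyadicAvg f n k ^ 2) / 2 ^ n) := by
  induction N with
  | zero => intro n k _ _; simp [stoppedSq]
  | succ N ih =>
    intro n k hk hr
    have hidx : ∀ y ∈ dyadicIco n k, dyadicIdx n y = k := fun y hy => dyadicIdx_of_mem hy
    by_cases hb : BoundedHalves f r n k
    · have h0 : ∫⁻ y in dyadicIco n k, stoppedSq f r (N + 1) n y =
          ∫⁻ y in dyadicIco n k, (ENNReal.ofReal (haarCoeff f n k ^ 2) +
            stoppedSq f r N (n + 1) y) :=
        setLIntegral_congr_fun (measurableSet_dyadicIco n k) fun y hy => by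
          rw [stoppedSq, hidx y hy, if_pos hb]
      have h1 := ih (n + 1) (2 * k) (by rw [pow_succ]; omega) hb.1
      have h2 := ih (n + 1) (2 * k + 1) (by rw [pow_succ]; omega) hb.2
      have e1 : 0 ≤ r ^ 2 - dyadicAvg f (n + 1) (2 * k) ^ 2 := by
        have := sq_le_sq' (abs_le.1 hb.1).1 (abs_le.1 hb.1).2
        linarith
      have e2 : 0 ≤ r ^ 2 - dyadicAvg f (n + 1) (2 * k + 1) ^ 2 := by
        have := sq_le_sq' (abs_le.1 hb.2).1 (abs_le.1 hb.2).2
        linarith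
      rw [h0, lintegral_add_left measurable_const, setLIntegral_const,
        lintegral_dyadicIco_split, volume_dyadicIco, ← ENNReal.ofReal_mul (sq_nonneg _)]
      refine (add_le_add_right (add_le_add h1 h2) _).trans ?_
      rw [← ENNReal.ofReal_add (by positivity) (by positivity),
        ← ENNReal.ofReal_add (by positivity) (by positivity)]
      apply ENNReal.ofReal_le_ofReal
      rw [dyadicAvg_two_mul hf hk, dyadicAvg_two_mul_add_one hf hk, pow_succ]
      apply le_of_eq
      field_simp
      ring
    · have h0 : ∫⁻ y in dyadicIco n k, stoppedSq f r (N + 1) n y =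
          ∫⁻ y in dyadicIco n k, 0 :=
        setLIntegral_congr_fun (measurableSet_dyadicIco n k) fun y hy => by
          rw [stoppedSq, hidx y hy, if_neg hb]
      rw [h0]
      simp

lemma ae_iSup_stoppedSq_lt_top (hf : IntegrableOn f (Set.Icc 0 1)) (hr : |dyadicAvg f 0 0| ≤ r) :
    ∀ᵐ y ∂(volume.restrict (Set.Icc (0 : ℝ) 1)), ⨆ N, stoppedSq f r N 0 y < ⊤ := by
  rw [← restrict_Ico_eq_restrict_Icc, ← dyadicIco_zero]
  apply ae_lt_top (Measurable.iSup fun N => measurable_stoppedSq N 0)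
  rw [lintegral_iSup (fun N => measurable_stoppedSq N 0)
    (monotone_nat_of_le_succ fun N y => stoppedSq_le_succ N 0 y)]
  exact ((iSup_le fun N => lintegral_stoppedSq_le hf N 0 0 (by simp) hr).trans_lt
    ENNReal.ofReal_lt_top).ne

lemma stoppedSq_eq_sum {y : ℝ} (hb : ∀ n, BoundedHalves f r n (dyadicIdx n y)) (N : ℕ) :
    ∀ n, stoppedSq f r N n y = ENNReal.ofReal
      (∑ m ∈ Finset.range N, haarCoeff f (n + m) (dyadicIdx (n + m) y) ^ 2) := by
  induction N with
  | zero => intro n; simp [stoppedSq]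
  | succ N ih =>
    intro n
    rw [stoppedSq, if_pos (hb n), ih (n + 1), Finset.sum_range_succ',
      ← ENNReal.ofReal_add (sq_nonneg _) (Finset.sum_nonneg fun _ _ => sq_nonneg _), add_comm]
    simp only [add_zero, add_assoc, add_comm 1]

end StoppedSq

section Convergence

variable {f : ℝ → ℝ}

lemma dyadicAvg_succ_sub (hf : IntegrableOn f (Set.Icc 0 1)) (n : ℕ) {y : ℝ}
    (hy : y ∈ Set.Ico (0 : ℝ) 1) :
    |dyadicAvg f (n + 1) (dyadicIdx (n + 1) y) - dyadicAvg f n (dyadicIdx n y)| =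
      |haarCoeff f n (dyadicIdx n y)| := by
  have hk := dyadicIdx_lt n hy
  have h := dyadicIdx_succ_div_two n y
  rcases (show dyadicIdx (n + 1) y = 2 * dyadicIdx n y ∨
      dyadicIdx (n + 1) y = 2 * dyadicIdx n y + 1 by omega) with h | h <;> rw [h]
  · rw [dyadicAvg_two_mul hf hk, sub_sub_cancel_left, abs_neg]
  · rw [dyadicAvg_two_mul_add_one hf hk, add_sub_cancel_left]

/-- The dyadic averages of an integrable function converge to it almost everywhere. -/
lemma ae_tendsto_dyadicAvg (hf : IntegrableOn f (Set.Icc 0 1)) :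
    ∀ᵐ y ∂(volume.restrict (Set.Icc (0 : ℝ) 1)),
      Filter.Tendsto (fun n => dyadicAvg f n (dyadicIdx n y)) Filter.atTop (nhds (f y)) := by
  have hloc : LocallyIntegrable ((Set.Icc (0 : ℝ) 1).indicator f) volume :=
    (hf.integrable_indicator measurableSet_Icc).locallyIntegrable
  filter_upwards [ae_restrict_of_ae (IsUnifLocDoublingMeasure.ae_tendsto_average volume hloc 1),
    ae_restrict_Icc_mem_Ico] with y hy hyI
  have hball : ∀ n : ℕ, Metric.closedBall (((dyadicIdx n y : ℝ) + 1 / 2) / 2 ^ n)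
      ((1 / 2) ^ n / 2) = Set.Icc ((dyadicIdx n y : ℝ) / 2 ^ n)
        (((dyadicIdx n y : ℝ) + 1) / 2 ^ n) := by
    intro n
    rw [Real.closedBall_eq_Icc, one_div_pow]
    congr 1
    · field_simp
      ring
    · field_simp
      ring
  have hlim : Filter.Tendsto (fun n : ℕ => ((1 : ℝ) / 2) ^ n / 2) Filter.atTop
      (nhdsWithin 0 (Set.Ioi 0)) := by
    refine tendsto_nhdsWithin_iff.2 ⟨?_, Filter.Eventually.of_forall fun n => by
      simp only [Set.mem_Ioi]; positivity⟩
    simpa using (tendsto_pow_atTop_nhds_zero_of_lt_one (r := (1 : ℝ) / 2) (by norm_num)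
      (by norm_num)).div_const 2
  have h := hy (fun n : ℕ => ((dyadicIdx n y : ℝ) + 1 / 2) / 2 ^ n) _ hlim
    (Filter.Eventually.of_forall fun n => by
      rw [one_mul, hball]
      exact Set.Ico_subset_Icc_self (mem_dyadicIco_dyadicIdx n hyI.1))
  rw [Set.indicator_of_mem (Set.Ico_subset_Icc_self hyI)] at h
  refine h.congr fun n => ?_
  have hsub := dyadicIco_subset_Icc (dyadicIdx_lt n hyI)
  rw [hball, setAverage_eq, integral_Icc_eq_integral_Ico, ← dyadicIco,
    setIntegral_congr_fun (measurableSet_dyadicIco _ _) fun z hz =>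
      Set.indicator_of_mem (hsub hz) f, measureReal_def, Real.volume_Icc,
    ENNReal.toReal_ofReal (sub_nonneg.2 (dyadic_left_le_right _ _)), dyadicAvg, smul_eq_mul]
  congr 1
  field_simp
  ring

/-- The square function of an integrable function is finite almost everywhere. -/
lemma ae_summable_haarCoeff_sq (hf : IntegrableOn f (Set.Icc 0 1)) :
    ∀ᵐ y ∂(volume.restrict (Set.Icc (0 : ℝ) 1)),
      Summable fun n => haarCoeff f n (dyadicIdx n y) ^ 2 := by
  have hfin : ∀ᵐ y ∂(volume.restrict (Set.Icc (0 : ℝ) 1)), ∀ r : ℕ, |dyadicAvg f 0 0| ≤ r →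
      ⨆ N, stoppedSq f r N 0 y < ⊤ :=
    ae_all_iff.2 fun r => by
      by_cases hr : |dyadicAvg f 0 0| ≤ r
      · filter_upwards [ae_iSup_stoppedSq_lt_top hf hr] with y hy _ using hy
      · exact Filter.Eventually.of_forall fun y h => absurd h hr
  filter_upwards [hfin, ae_tendsto_dyadicAvg hf, ae_restrict_Icc_mem_Ico] with y hy hlim hyI
  obtain ⟨C, hC⟩ := hlim.norm.bddAbove_range
  have hE : ∀ n, |dyadicAvg f n (dyadicIdx n y)| ≤ C := fun n => hC ⟨n, rfl⟩
  obtain ⟨r, hr⟩ := exists_nat_ge (3 * C)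
  have hC0 : 0 ≤ C := (abs_nonneg _).trans (hE 0)
  have hb : ∀ n, BoundedHalves f r n (dyadicIdx n y) := by
    intro n
    have hk := dyadicIdx_lt n hyI
    have h1 := abs_le.1 (hE n)
    have h2 := abs_le.1 (hE (n + 1))
    have h3 := dyadicAvg_succ_sub hf n hyI
    have h4 : |haarCoeff f n (dyadicIdx n y)| ≤ 2 * C := by
      rw [← h3, abs_le]
      constructor <;> linarith
    have h5 := abs_le.1 h4
    rw [BoundedHalves, dyadicAvg_two_mul hf hk, dyadicAvg_two_mul_add_one hf hk, abs_le, abs_le]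
    refine ⟨⟨?_, ?_⟩, ?_, ?_⟩ <;> linarith
  have h0 : |dyadicAvg f 0 0| ≤ r := by
    have := hE 0
    rw [show dyadicIdx 0 y = 0 by simpa using dyadicIdx_lt 0 hyI] at this
    linarith
  have hs := hy r h0
  refine summable_of_sum_range_le (c := (⨆ N, stoppedSq f r N 0 y).toReal)
    (fun n => sq_nonneg _) fun N => ?_
  have h1 := le_iSup (fun N => stoppedSq f r N 0 y) N
  simp only [stoppedSq_eq_sum hb N 0, zero_add] at h1
  exact (ENNReal.ofReal_le_iff_le_toReal hs.ne).1 h1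

end Convergence

lemma Admissible.sqBounded {f : ℝ → ℝ} (h : Admissible f) : SqBounded 1 f := by
  obtain ⟨hf, h0, hS⟩ := h
  refine ⟨hf, h0, fun n k hk => ?_⟩
  have hae : ∀ᵐ y ∂(volume.restrict (dyadicIco n k)),
      ∀ n, ancestorSq f n (dyadicIdx n y) ≤ 1 := by
    refine ae_restrict_of_ae_restrict_of_subset (dyadicIco_subset_Icc hk) ?_
    filter_upwards [hS, ae_summable_haarCoeff_sq hf, ae_restrict_Icc_mem_Ico,
      ae_restrict_of_ae ae_ne_dyadic] with y h1 h2 hy hd n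
    rw [sqFn_eq_sqrt_tsum f hy.1 hd, Real.sqrt_le_one] at h1
    rw [ancestorSq_dyadicIdx]
    exact (h2.sum_le_tsum _ fun _ _ => sq_nonneg _).trans h1
  have hne : volume.restrict (dyadicIco n k) ≠ 0 := by
    rw [Ne, Measure.restrict_eq_zero, volume_dyadicIco]
    simp
  have : (ae (volume.restrict (dyadicIco n k))).NeBot := ae_neBot.2 hne
  obtain ⟨y, hy, hyJ⟩ := (hae.and (ae_restrict_mem (measurableSet_dyadicIco n k))).exists
  have := hy n
  rwa [dyadicIdx_of_mem hyJ] at this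

lemma measureReal_dyadicIco_inter (n k : ℕ) (s : Set ℝ) :
    volume.real (dyadicIco n k ∩ s) = volume.real (dyadicIco (n + 1) (2 * k) ∩ s) +
      volume.real (dyadicIco (n + 1) (2 * k + 1) ∩ s) := by
  have hfin : volume (dyadicIco n k ∩ s) ≠ ⊤ :=
    ((measure_mono Set.inter_subset_left).trans_lt
      (by rw [volume_dyadicIco]; exact ENNReal.ofReal_lt_top)).ne
  rw [← measureReal_inter_add_sdiff (measurableSet_dyadicIco (n + 1) (2 * k)) hfin]
  have hd := Set.disjoint_left.1 (disjoint_dyadicIco n k)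
  congr 2
  · rw [dyadicIco_split]
    ext y
    simp only [Set.mem_inter_iff, Set.mem_union]
    tauto
  · rw [dyadicIco_split]
    ext y
    have := @hd y
    simp only [Set.mem_inter_iff, Set.mem_union, Set.mem_sdiff]
    tauto

/-- The distribution of the dyadic averages of a function is that of a walk. -/
lemma SqBounded.walkProb_dyadicIco {f : ℝ → ℝ} {t : ℝ} (h : SqBounded t f) (x : ℝ) (d : ℕ) :
    ∀ n k, k < 2 ^ n → WalkProb (t - ancestorSq f n k) (x - dyadicAvg f n k)
      (2 ^ n * volume.real (dyadicIco n k ∩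
        {y | x ≤ dyadicAvg f (n + d) (dyadicIdx (n + d) y)})) := by
  induction d with
  | zero =>
    intro n k hk
    have ht : 0 ≤ t - ancestorSq f n k := sub_nonneg.2 (h.ancestorSq_le n k hk)
    by_cases hx : x ≤ dyadicAvg f n k
    · have hset : dyadicIco n k ∩ {y | x ≤ dyadicAvg f (n + 0) (dyadicIdx (n + 0) y)} =
          dyadicIco n k := Set.inter_eq_left.2 fun y hy => by
        simpa only [Set.mem_ofPred_eq, add_zero, dyadicIdx_of_mem hy] using hx
      rw [hset, measureReal_def, volume_dyadicIco, ENNReal.toReal_ofReal (by positivity),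
        mul_one_div_cancel (by positivity)]
      exact .leaf_nonpos ht (by linarith)
    · have hset : dyadicIco n k ∩ {y | x ≤ dyadicAvg f (n + 0) (dyadicIdx (n + 0) y)} = ∅ := by
        refine Set.eq_empty_of_forall_notMem fun y hy => hx ?_
        simpa only [Set.mem_ofPred_eq, add_zero, dyadicIdx_of_mem hy.1] using hy.2
      rw [hset, measureReal_empty, mul_zero]
      exact .leaf_pos ht (by linarith)
  | succ d ih =>
    intro n k hk
    have h1 := ih (n + 1) (2 * k) (by rw [pow_succ]; omega)
    have h2 := ih (n + 1) (2 * k + 1) (by rw [pow_succ]; omega)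
    have e1 : ancestorSq f (n + 1) (2 * k) = ancestorSq f n k + haarCoeff f n k ^ 2 := by
      rw [ancestorSq, Nat.mul_div_cancel_left k two_pos]
    have e2 : ancestorSq f (n + 1) (2 * k + 1) = ancestorSq f n k + haarCoeff f n k ^ 2 := by
      rw [ancestorSq, show (2 * k + 1) / 2 = k by omega]
    rw [e1, dyadicAvg_two_mul h.integrableOn hk, ← sub_sub, ← sub_add,
      show n + 1 + d = n + (d + 1) by ring] at h1
    rw [e2, dyadicAvg_two_mul_add_one h.integrableOn hk, ← sub_sub, ← sub_sub,
      show n + 1 + d = n + (d + 1) by ring] at h2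
    convert WalkProb.node _ h1 h2 using 1
    rw [measureReal_dyadicIco_inter]
    ring

lemma measurable_dyadicAvg_dyadicIdx (f : ℝ → ℝ) (n : ℕ) :
    Measurable fun y => dyadicAvg f n (dyadicIdx n y) :=
  (measurable_of_countable (dyadicAvg f n)).comp (measurable_dyadicIdx n)

lemma volume_Icc_inter (s : Set ℝ) : volume (Set.Icc 0 1 ∩ s) = volume (dyadicIco 0 0 ∩ s) := by
  rw [dyadicIco_zero]
  exact measure_congr (Ico_ae_eq_Icc.symm.inter (ae_eq_refl s))

lemma SqBounded.measure_dyadicAvg_le {f : ℝ → ℝ} (h : SqBounded 1 f) (x : ℝ) (n : ℕ) :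
    volume (Set.Icc 0 1 ∩ {y | x ≤ dyadicAvg f n (dyadicIdx n y)}) ≤
      ENNReal.ofReal (walkSup x) := by
  have h1 := h.walkProb_dyadicIco x n 0 0 (by simp)
  rw [dyadicAvg_zero, h.integral_eq_zero, zero_add, ancestorSq, sub_zero, sub_zero, pow_zero,
    one_mul] at h1
  rw [volume_Icc_inter, ENNReal.le_ofReal_iff_toReal_le _ (walkSup_nonneg x)]
  · exact h1.le_walkSup_one
  · refine ((measure_mono Set.inter_subset_left).trans_lt ?_).ne
    rw [volume_dyadicIco]
    exact ENNReal.ofReal_lt_top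

/-- Distribution estimate for admissible functions at heights below `x`. -/
lemma Admissible.measure_le_walkSup {f : ℝ → ℝ} (h : Admissible f) {x y : ℝ} (hyx : y < x) :
    (volume {z ∈ Set.Icc (0 : ℝ) 1 | x ≤ f z}).toReal ≤ walkSup y := by
  set μ := volume.restrict (Set.Icc (0 : ℝ) 1) with hμ
  have hconv := tendstoInMeasure_of_tendsto_ae (μ := μ)
    (fun n => (measurable_dyadicAvg_dyadicIdx f n).aestronglyMeasurable)
    (ae_tendsto_dyadicAvg h.1)
  have hlim := hconv (ENNReal.ofReal (x - y)) (by simpa using hyx)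
  have hbound : ∀ n, volume {z ∈ Set.Icc (0 : ℝ) 1 | x ≤ f z} ≤ ENNReal.ofReal (walkSup y) +
      μ {z | ENNReal.ofReal (x - y) ≤ edist (dyadicAvg f n (dyadicIdx n z)) (f z)} := by
    intro n
    refine le_trans ?_ (add_le_add_left (h.sqBounded.measure_dyadicAvg_le y n) _)
    rw [hμ, Measure.restrict_apply' measurableSet_Icc]
    refine (measure_mono fun z hz => ?_).trans (measure_union_le _ _)
    by_cases hz' : y ≤ dyadicAvg f n (dyadicIdx n z)
    · exact Or.inl ⟨hz.1, hz'⟩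
    · refine Or.inr ⟨?_, hz.1⟩
      have := hz.2
      rw [Set.mem_ofPred_eq, edist_dist, Real.dist_eq, abs_sub_comm]
      apply ENNReal.ofReal_le_ofReal
      exact le_trans (by linarith) (le_abs_self _)
  have h1 := ge_of_tendsto' (hlim.const_add (ENNReal.ofReal (walkSup y))) hbound
  rw [add_zero] at h1
  exact ENNReal.toReal_le_of_le_ofReal (walkSup_nonneg y) h1

section Concat

/-- The function with mean-zero parts `f₁ - a` and `f₂ + a`, rescaled to the two halves of
`[0,1]`. -/
def haarConcat (a : ℝ) (f₁ f₂ : ℝ → ℝ) (y : ℝ) : ℝ :=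
  if y < 1 / 2 then f₁ (2 * y) - a else f₂ (2 * y - 1) + a

variable {a t : ℝ} {f f₁ f₂ : ℝ → ℝ} {n k : ℕ}

lemma dyadicAvg_add_const (hf : IntegrableOn f (Set.Icc 0 1)) (hk : k < 2 ^ n) (b : ℝ) :
    dyadicAvg (fun y => f y + b) n k = dyadicAvg f n k + b := by
  have hfin : volume (dyadicIco n k) ≠ ⊤ := by
    rw [volume_dyadicIco]
    exact ENNReal.ofReal_ne_top
  rw [dyadicAvg, integral_add (hf.mono_set (dyadicIco_subset_Icc hk)) (integrableOn_const hfin),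
    setIntegral_const, measureReal_def, volume_dyadicIco, ENNReal.toReal_ofReal (by positivity),
    dyadicAvg, smul_eq_mul]
  field_simp

lemma dyadicAvg_comp_two_mul_sub (g : ℝ → ℝ) (n k d : ℕ) :
    dyadicAvg (fun y => g (2 * y - d)) (n + 1) (2 ^ n * d + k) = dyadicAvg g n k := by
  have e1 : 2 * (((2 ^ n * d + k : ℕ) : ℝ) / 2 ^ (n + 1)) - d = (k : ℝ) / 2 ^ n := by
    push_cast
    rw [pow_succ]
    field_simp
    ring
  have e2 : 2 * ((((2 ^ n * d + k : ℕ) : ℝ) + 1) / 2 ^ (n + 1)) - d = ((k : ℝ) + 1) / 2 ^ n := by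
    push_cast
    rw [pow_succ]
    field_simp
    ring
  rw [dyadicAvg_eq_intervalIntegral, dyadicAvg_eq_intervalIntegral,
    intervalIntegral.integral_comp_mul_sub g two_ne_zero, e1, e2, smul_eq_mul, pow_succ]
  ring

lemma two_mul_sub_mem_of_mem_dyadicIco {d : ℕ} {y : ℝ} (hy : y ∈ dyadicIco 1 d) :
    2 * y - d ∈ Set.Ico (0 : ℝ) 1 := by
  obtain ⟨h1, h2⟩ := hy
  rw [pow_one, div_le_iff₀ two_pos] at h1
  rw [pow_one, lt_div_iff₀ two_pos] at h2
  constructor <;> linarith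

lemma dyadicIco_succ_subset (n k d : ℕ) (hk : k < 2 ^ n) :
    dyadicIco (n + 1) (2 ^ n * d + k) ⊆ dyadicIco 1 d := by
  have h2 : (0 : ℝ) < 2 ^ n := by positivity
  have hk' : (k : ℝ) + 1 ≤ 2 ^ n := by exact_mod_cast hk
  apply Set.Ico_subset_Ico
  · rw [div_le_div_iff₀ (by positivity) (by positivity), pow_succ 2 n, pow_one]
    push_cast
    nlinarith [Nat.cast_nonneg (α := ℝ) k]
  · rw [div_le_div_iff₀ (by positivity) (by positivity), pow_succ 2 n, pow_one]
    push_cast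
    nlinarith

lemma haarConcat_of_mem_left {y : ℝ} (hy : y ∈ dyadicIco 1 0) :
    haarConcat a f₁ f₂ y = f₁ (2 * y - (0 : ℕ)) + -a := by
  have h := two_mul_sub_mem_of_mem_dyadicIco hy
  simp only [Nat.cast_zero, sub_zero] at h ⊢
  rw [haarConcat, if_pos (by linarith [h.2])]
  ring

lemma haarConcat_of_mem_right {y : ℝ} (hy : y ∈ dyadicIco 1 1) :
    haarConcat a f₁ f₂ y = f₂ (2 * y - (1 : ℕ)) + a := by
  have h := two_mul_sub_mem_of_mem_dyadicIco hy
  simp only [Nat.cast_one] at h ⊢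
  rw [haarConcat, if_neg (by linarith [h.1])]

lemma dyadicAvg_haarConcat_left (hf : IntegrableOn f₁ (Set.Icc 0 1)) (hk : k < 2 ^ n) :
    dyadicAvg (haarConcat a f₁ f₂) (n + 1) k = dyadicAvg f₁ n k - a := by
  have h1 := dyadicIco_succ_subset n k 0 hk
  have h2 := dyadicAvg_comp_two_mul_sub (fun u => f₁ u + -a) n k 0
  rw [dyadicAvg_add_const hf hk] at h2
  rw [mul_zero, zero_add] at h1 h2
  rw [sub_eq_add_neg, ← h2, dyadicAvg, dyadicAvg, setIntegral_congr_fun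
    (measurableSet_dyadicIco _ _) fun y hy => haarConcat_of_mem_left (h1 hy)]

lemma dyadicAvg_haarConcat_right (hf : IntegrableOn f₂ (Set.Icc 0 1)) (hk : k < 2 ^ n) :
    dyadicAvg (haarConcat a f₁ f₂) (n + 1) (2 ^ n + k) = dyadicAvg f₂ n k + a := by
  have h1 := dyadicIco_succ_subset n k 1 hk
  have h2 := dyadicAvg_comp_two_mul_sub (fun u => f₂ u + a) n k 1
  rw [dyadicAvg_add_const hf hk] at h2
  rw [mul_one] at h1 h2
  rw [← h2, dyadicAvg, dyadicAvg, setIntegral_congr_fun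
    (measurableSet_dyadicIco _ _) fun y hy => haarConcat_of_mem_right (h1 hy)]

lemma integrableOn_comp_two_mul_sub (hf : IntegrableOn f (Set.Icc 0 1)) (d : ℕ) :
    IntegrableOn (fun y => f (2 * y - d)) (dyadicIco 1 d) := by
  have h := (((hf.integrable_indicator measurableSet_Icc).comp_sub_right (d : ℝ)).comp_mul_left'
    two_ne_zero).integrableOn (s := dyadicIco 1 d)
  refine h.congr_fun (fun y hy => ?_) (measurableSet_dyadicIco 1 d)
  exact Set.indicator_of_mem (Set.Ico_subset_Icc_self (two_mul_sub_mem_of_mem_dyadicIco hy)) f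

lemma integrableOn_haarConcat (hf₁ : IntegrableOn f₁ (Set.Icc 0 1))
    (hf₂ : IntegrableOn f₂ (Set.Icc 0 1)) :
    IntegrableOn (haarConcat a f₁ f₂) (Set.Icc 0 1) := by
  have hfin : ∀ d, volume (dyadicIco 1 d) ≠ ⊤ := fun d => by
    rw [volume_dyadicIco]
    exact ENNReal.ofReal_ne_top
  rw [integrableOn_Icc_iff_integrableOn_Ico, ← dyadicIco_zero, dyadicIco_split]
  apply IntegrableOn.union
  · exact ((integrableOn_comp_two_mul_sub hf₁ 0).add (integrableOn_const (hfin 0)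
      (C := -a))).congr_fun (fun y hy => (haarConcat_of_mem_left hy).symm)
      (measurableSet_dyadicIco _ _)
  · exact ((integrableOn_comp_two_mul_sub hf₂ 1).add (integrableOn_const (hfin 1)
      (C := a))).congr_fun (fun y hy => (haarConcat_of_mem_right hy).symm)
      (measurableSet_dyadicIco _ _)

lemma SqBounded.haarConcat (h₁ : SqBounded (t - a ^ 2) f₁) (h₂ : SqBounded (t - a ^ 2) f₂) :
    SqBounded t (haarConcat a f₁ f₂) := by
  have hi := integrableOn_haarConcat (a := a) h₁.integrableOn h₂.integrableOn
  have hl : dyadicAvg (_root_.haarConcat a f₁ f₂) 1 0 = -a := by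
    rw [dyadicAvg_haarConcat_left h₁.integrableOn (n := 0) (by simp), dyadicAvg_zero,
      h₁.integral_eq_zero, zero_sub]
  have hr : dyadicAvg (_root_.haarConcat a f₁ f₂) 1 1 = a := by
    have := dyadicAvg_haarConcat_right (a := a) (f₁ := f₁) h₂.integrableOn (n := 0) (k := 0)
      (by simp)
    simpa only [dyadicAvg_zero, h₂.integral_eq_zero, zero_add, pow_zero, add_zero] using this
  have hc0 : haarCoeff (_root_.haarConcat a f₁ f₂) 0 0 = a := by
    rw [haarCoeff_eq hi (by simp)]
    simp only [zero_add, mul_zero, hl, hr]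
    ring
  have hcl : ∀ n k, k < 2 ^ n →
      haarCoeff (_root_.haarConcat a f₁ f₂) (n + 1) k = haarCoeff f₁ n k := by
    intro n k hk
    rw [haarCoeff_eq hi (by rw [pow_succ]; omega), haarCoeff_eq h₁.integrableOn hk,
      dyadicAvg_haarConcat_left h₁.integrableOn (by rw [pow_succ]; omega),
      dyadicAvg_haarConcat_left h₁.integrableOn (by rw [pow_succ]; omega)]
    ring
  have hcr : ∀ n k, k < 2 ^ n →
      haarCoeff (_root_.haarConcat a f₁ f₂) (n + 1) (2 ^ n + k) = haarCoeff f₂ n k := by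
    intro n k hk
    rw [haarCoeff_eq hi (by rw [pow_succ]; omega), haarCoeff_eq h₂.integrableOn hk,
      show 2 * (2 ^ n + k) = 2 ^ (n + 1) + 2 * k by ring, add_assoc (2 ^ (n + 1)),
      dyadicAvg_haarConcat_right h₂.integrableOn (by rw [pow_succ]; omega),
      dyadicAvg_haarConcat_right h₂.integrableOn (by rw [pow_succ]; omega)]
    ring
  have hsl : ∀ n k, k < 2 ^ n →
      ancestorSq (_root_.haarConcat a f₁ f₂) (n + 1) k = a ^ 2 + ancestorSq f₁ n k := by
    intro n
    induction n with
    | zero =>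
      intro k hk
      obtain rfl : k = 0 := by simpa using hk
      simp [ancestorSq, hc0]
    | succ n ih =>
      intro k hk
      rw [pow_succ] at hk
      rw [ancestorSq, ih _ (by omega), hcl n _ (by omega), ancestorSq, add_assoc]
  have hsr : ∀ n k, k < 2 ^ n →
      ancestorSq (_root_.haarConcat a f₁ f₂) (n + 1) (2 ^ n + k) = a ^ 2 + ancestorSq f₂ n k := by
    intro n
    induction n with
    | zero =>
      intro k hk
      obtain rfl : k = 0 := by simpa using hk
      simp [ancestorSq, hc0]
    | succ n ih =>
      intro k hk
      rw [pow_succ] at hk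
      rw [ancestorSq, show (2 ^ (n + 1) + k) / 2 = 2 ^ n + k / 2 by rw [pow_succ]; omega,
        ih _ (by omega), hcr n _ (by omega), ancestorSq, add_assoc]
  refine ⟨hi, ?_, ?_⟩
  · rw [← dyadicAvg_zero, dyadicAvg_split hi (by simp)]
    simp only [zero_add, mul_zero, hl, hr]
    ring
  · rintro (_ | n) k hk
    · have := h₁.ancestorSq_le 0 0 (by simp)
      rw [ancestorSq] at this ⊢
      nlinarith [sq_nonneg a]
    · rcases lt_or_ge k (2 ^ n) with hlt | hge
      · have := h₁.ancestorSq_le n k hlt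
        rw [hsl n k hlt]
        linarith
      · obtain ⟨j, rfl⟩ := Nat.exists_eq_add_of_le hge
        have hj : j < 2 ^ n := by rw [pow_succ] at hk; omega
        have := h₂.ancestorSq_le n j hj
        rw [hsr n j hj]
        linarith

lemma measureReal_preimage_two_mul_sub (s : Set ℝ) (d : ℕ) :
    volume.real (dyadicIco 1 d ∩ {y | 2 * y - d ∈ s}) = volume.real (dyadicIco 0 0 ∩ s) / 2 := by
  have hset : dyadicIco 1 d ∩ {y | 2 * y - d ∈ s} =
      (fun y : ℝ => 2 * y) ⁻¹' ((fun u : ℝ => u + -(d : ℝ)) ⁻¹' (dyadicIco 0 0 ∩ s)) := by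
    ext y
    rw [dyadicIco_zero]
    simp only [Set.mem_inter_iff, Set.mem_ofPred_eq, Set.mem_preimage, ← sub_eq_add_neg]
    refine and_congr_left fun _ => ⟨two_mul_sub_mem_of_mem_dyadicIco, fun h => ?_⟩
    rw [dyadicIco, pow_one, Set.mem_Ico, div_le_iff₀ two_pos, lt_div_iff₀ two_pos]
    constructor <;> linarith [h.1, h.2]
  rw [hset, measureReal_def, Real.volume_preimage_mul_left two_ne_zero,
    measure_preimage_add_right, ENNReal.toReal_mul, ENNReal.toReal_ofReal (abs_nonneg _),
    measureReal_def, abs_of_pos (by norm_num)]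
  ring

lemma measureReal_haarConcat (x a : ℝ) (f₁ f₂ : ℝ → ℝ) :
    volume.real (dyadicIco 0 0 ∩ {y | x ≤ haarConcat a f₁ f₂ y}) =
      (volume.real (dyadicIco 0 0 ∩ {y | x + a ≤ f₁ y}) +
        volume.real (dyadicIco 0 0 ∩ {y | x - a ≤ f₂ y})) / 2 := by
  rw [measureReal_dyadicIco_inter, add_div, ← measureReal_preimage_two_mul_sub _ 0,
    ← measureReal_preimage_two_mul_sub _ 1]
  congr 2
  · ext y
    refine and_congr_right fun hy => ?_
    rw [Set.mem_ofPred_eq, haarConcat_of_mem_left hy, ← sub_eq_add_neg, le_sub_iff_add_le]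
    rfl
  · ext y
    refine and_congr_right fun hy => ?_
    rw [Set.mem_ofPred_eq, haarConcat_of_mem_right hy, ← sub_le_iff_le_add]
    rfl

end Concat

lemma haarCoeff_zero (n k : ℕ) : haarCoeff (fun _ => 0) n k = 0 := by simp [haarCoeff]

lemma sqBounded_zero {t : ℝ} (ht : 0 ≤ t) : SqBounded t fun _ => 0 := by
  refine ⟨integrableOn_zero, by simp, fun n => ?_⟩
  have : ∀ k, ancestorSq (fun _ => 0) n k = 0 := by
    induction n with
    | zero => exact fun _ => rfl
    | succ n ih => intro k; rw [ancestorSq, ih, haarCoeff_zero]; simp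
  intro k _
  rwa [this]

/-- Every walk is realized by a dyadic step function. -/
lemma WalkProb.exists_sqBounded {t x p : ℝ} (h : WalkProb t x p) :
    ∃ f, SqBounded t f ∧ volume.real (dyadicIco 0 0 ∩ {y | x ≤ f y}) = p := by
  induction h with
  | leaf_pos ht hx =>
    refine ⟨fun _ => 0, sqBounded_zero ht, ?_⟩
    simp [hx.not_ge]
  | leaf_nonpos ht hx =>
    refine ⟨fun _ => 0, sqBounded_zero ht, ?_⟩
    simp [hx, measureReal_def, volume_dyadicIco]
  | node a _ _ ih₁ ih₂ =>
    obtain ⟨f₁, h₁, rfl⟩ := ih₁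
    obtain ⟨f₂, h₂, rfl⟩ := ih₂
    exact ⟨haarConcat a f₁ f₂, h₁.haarConcat h₂, measureReal_haarConcat _ _ _ _⟩

lemma bellman_eq_walkSup {x : ℝ} (hx : 0 < x) : bellman x = walkSup x := by
  have hle : ∀ m ∈ { m : ℝ | ∃ f : ℝ → ℝ, Admissible f ∧
      m = (volume { y ∈ Set.Icc (0 : ℝ) 1 | x ≤ f y }).toReal }, m ≤ walkSup x := by
    rintro m ⟨f, hf, rfl⟩
    exact le_walkSup_of_forall_lt hx fun y hy => hf.measure_le_walkSup hy
  apply le_antisymm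
  · exact csSup_le ⟨_, _, (sqBounded_zero zero_le_one).admissible, rfl⟩ hle
  · refine csSup_le (setOf_walkProb_nonempty x) fun p hp => le_csSup ⟨_, hle⟩ ?_
    obtain ⟨f, hf, rfl⟩ := WalkProb.exists_sqBounded hp
    exact ⟨f, hf.admissible, congrArg ENNReal.toReal (volume_Icc_inter _).symm⟩

theorem bellman_eq_const_mul_gaussPhi :
    ∃ c : ℝ, 0 < c ∧ c = bellman (Real.sqrt 3) / gaussPhi (Real.sqrt 3) ∧
      ∀ x : ℝ, Real.sqrt 3 ≤ x → bellman x = c * gaussPhi x := by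
  have h3 : (0 : ℝ) < √3 := by positivity
  refine ⟨_, ?_, rfl, fun x hx => ?_⟩
  · rw [bellman_eq_walkSup h3]
    exact div_pos (walkSup_pos h3.le) (gaussPhi_pos _)
  · rw [bellman_eq_walkSup h3, bellman_eq_walkSup (h3.trans_le hx)]
    exact walkSup_eq_const_mul_gaussPhi hx
end
end

section
/- For all s, t ∈ [0,1/2], A((s+t)/2) ≥ M[A(s), A(t)]. -/
open MeasureTheory

noncomputable section

/-- The nonlinear mean `M[a,b] = (a+b)/√(4+(a-b)²)`. -/
def nlMean (a b : ℝ) : ℝ := (a + b) / Real.sqrt (4 + (a - b) ^ 2)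

lemma nlMean_comm (a b : ℝ) : nlMean a b = nlMean b a := by
  unfold nlMean
  rw [add_comm a b, show (a - b) ^ 2 = (b - a) ^ 2 by ring]

lemma nlMean_self (a : ℝ) : nlMean a a = a := by
  have h : Real.sqrt 4 = 2 := by
    rw [show (4 : ℝ) = 2 ^ 2 by norm_num]
    exact Real.sqrt_sq (by norm_num)
  simp only [nlMean, sub_self, ne_eq, OfNat.ofNat_ne_zero, not_false_eq_true, zero_pow, add_zero, h]
  ring

lemma continuous_nlMean : Continuous fun p : ℝ × ℝ => nlMean p.1 p.2 := by
  unfold nlMean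
  refine Continuous.div (by fun_prop) (by fun_prop) fun p => ?_
  positivity

lemma nlMean_le_nlMean {a b c d : ℝ} (hcd : 0 ≤ c + d)
    (h : (a + b) ^ 2 * (1 - c * d) ≤ (c + d) ^ 2 * (1 - a * b)) :
    nlMean a b ≤ nlMean c d := by
  unfold nlMean
  rw [div_le_div_iff₀ (by positivity) (by positivity)]
  refine le_of_sq_le_sq ?_ (by positivity)
  rw [mul_pow, mul_pow, Real.sq_sqrt (by positivity), Real.sq_sqrt (by positivity)]
  linear_combination 4 * h

lemma nlMean_le_nlMean_right {a x y : ℝ} (ha : 0 ≤ a) (ha1 : a ≤ 1) (hx : 0 ≤ x) (hx1 : x ≤ 1)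
    (hxy : x ≤ y) : nlMean a x ≤ nlMean a y := by
  refine nlMean_le_nlMean (by linarith) ?_
  have hax : a * x ≤ 1 := mul_le_one₀ ha1 hx hx1
  calc (a + x) ^ 2 * (1 - a * y) ≤ (a + x) ^ 2 * (1 - a * x) := by gcongr
    _ ≤ (a + y) ^ 2 * (1 - a * x) := by
        have : 0 ≤ 1 - a * x := by linarith
        gcongr

lemma nlMean_mono {a b x y : ℝ} (ha : 0 ≤ a) (hab : a ≤ b) (hb : b ≤ 1) (hx : 0 ≤ x)
    (hxy : x ≤ y) (hy : y ≤ 1) : nlMean a x ≤ nlMean b y :=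
  (nlMean_le_nlMean_right ha (hab.trans hb) hx (hxy.trans hy) hxy).trans <| by
    rw [nlMean_comm a y, nlMean_comm b y]
    exact nlMean_le_nlMean_right (hx.trans hxy) hy ha (hab.trans hb) hab

lemma le_nlMean {a b : ℝ} (ha : 0 ≤ a) (hab : a ≤ b) (hb : b ≤ 1) : a ≤ nlMean a b := by
  simpa [nlMean_self] using nlMean_mono ha le_rfl (hab.trans hb) ha hab hb

lemma nlMean_le {a b : ℝ} (ha : 0 ≤ a) (hab : a ≤ b) (hb : b ≤ 1) : nlMean a b ≤ b := by
  simpa [nlMean_self] using nlMean_mono ha hab hb (ha.trans hab) le_rfl hb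

lemma nlMean_mem {a b : ℝ} (ha : a ∈ Set.Icc (0 : ℝ) 1) (hb : b ∈ Set.Icc (0 : ℝ) 1) :
    nlMean a b ∈ Set.Icc (0 : ℝ) 1 := by
  rcases le_total a b with h | h
  · exact ⟨ha.1.trans (le_nlMean ha.1 h hb.2), (nlMean_le ha.1 h hb.2).trans hb.2⟩
  · rw [nlMean_comm]
    exact ⟨hb.1.trans (le_nlMean hb.1 h ha.2), (nlMean_le hb.1 h ha.2).trans ha.2⟩

/-- Writing `b - a = 2 tan φ`, the mean of `a` and `b` is `a cos φ + sin φ`; here `t = tan φ` and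
`c = cos φ`. -/
lemma exists_nlMean_eq {a b : ℝ} (h : |b - a| ≤ 1) :
    ∃ c t : ℝ, b = a + 2 * t ∧ 0 < c ∧ c ^ 2 * (1 + t ^ 2) = 1 ∧ 4 / 5 ≤ c ^ 2 ∧ |t| ≤ 1 / 2 ∧
      nlMean a b = a * c + t * c := by
  have ht : |(b - a) / 2| ≤ 1 / 2 := by
    rw [abs_div, abs_two]
    linarith
  have hc : (Real.sqrt (1 + ((b - a) / 2) ^ 2))⁻¹ ^ 2 = (1 + ((b - a) / 2) ^ 2)⁻¹ := by
    rw [inv_pow, Real.sq_sqrt (by positivity)]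
  have ht2 : ((b - a) / 2) ^ 2 ≤ (1 / 2) ^ 2 := sq_le_sq' (abs_le.1 ht).1 (abs_le.1 ht).2
  refine ⟨(Real.sqrt (1 + ((b - a) / 2) ^ 2))⁻¹, (b - a) / 2, by ring, by positivity, ?_, ?_, ht, ?_⟩
  · rw [hc, inv_mul_cancel₀ (by positivity)]
  · rw [hc, le_inv_comm₀ (by norm_num) (by positivity)]
    linarith
  · have h4 : Real.sqrt (4 + (a - b) ^ 2) = 2 * Real.sqrt (1 + ((b - a) / 2) ^ 2) := by
      rw [show 4 + (a - b) ^ 2 = 2 ^ 2 * (1 + ((b - a) / 2) ^ 2) by ring,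
        Real.sqrt_mul (by norm_num), Real.sqrt_sq (by norm_num)]
    rw [nlMean, h4]
    field_simp
    ring

section PolynomialInequalities

variable {z e : ℝ}

lemma bernsteinCoeff_zero_nonneg (hz : 0 ≤ z) (he : 0 ≤ e) (h : z + e ≤ 1 / 5) :
    0 ≤ 22 / 15 * e + 11 / 15 * z - 1 / 30 * e ^ 2 + 82 / 15 * z * e + 71 / 30 * z ^ 2
      - 224 / 15 * e ^ 3 - 376 / 15 * z * e ^ 2 - 68 / 5 * z ^ 2 * e - 12 / 5 * z ^ 3
      + 32 / 3 * z * e ^ 3 + 178 / 15 * z ^ 2 * e ^ 2 + 19 / 5 * z ^ 3 * e + 4 / 15 * z ^ 4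
      - 32 / 15 * z ^ 2 * e ^ 3 - 32 / 15 * z ^ 3 * e ^ 2 - 8 / 15 * z ^ 4 * e := by
  have hx : 0 ≤ 1 / 5 - z - e := by linarith
  have hze := mul_nonneg hz he
  nlinarith [mul_nonneg hx hz, mul_nonneg hx he, mul_nonneg hx hze,
    mul_nonneg hx (mul_nonneg he he), mul_nonneg hx (mul_nonneg hz hz),
    mul_nonneg hz (mul_nonneg hz hz), mul_nonneg (mul_nonneg hze hz) hx,
    mul_nonneg (mul_nonneg hze he) hx, mul_nonneg (mul_nonneg hze hze) hx,
    mul_nonneg (mul_nonneg hze (mul_nonneg hz hz)) hx, mul_nonneg hz hze, mul_nonneg he hze]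

lemma bernsteinCoeff_one_nonneg (hz : 0 ≤ z) (he : 0 ≤ e) (h : z + e ≤ 1 / 5) :
    0 ≤ 1 / 15 - 5 / 6 * e - 11 / 15 * z + 161 / 30 * e ^ 2 + 209 / 15 * z * e
      + 157 / 30 * z ^ 2 - 68 / 5 * e ^ 3 - 263 / 10 * z * e ^ 2 - 218 / 15 * z ^ 2 * e
      - 13 / 5 * z ^ 3 + 52 / 5 * z * e ^ 3 + 12 * z ^ 2 * e ^ 2 + 103 / 30 * z ^ 3 * e
      - 12 / 5 * z ^ 2 * e ^ 3 - 8 / 3 * z ^ 3 * e ^ 2 - 4 / 5 * z ^ 4 * e := by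
  have hx : 0 ≤ 1 / 5 - z - e := by linarith
  have hze := mul_nonneg hz he
  nlinarith [mul_nonneg hx hx, mul_nonneg hx (mul_nonneg hx hx), mul_nonneg hx hz,
    mul_nonneg hx he, mul_nonneg hx hze, mul_nonneg hx (mul_nonneg he he),
    mul_nonneg hx (mul_nonneg hz hz), mul_nonneg hz (mul_nonneg hz hz),
    mul_nonneg (mul_nonneg hze hz) hx, mul_nonneg (mul_nonneg hze he) hx,
    mul_nonneg (mul_nonneg hze hze) hx, mul_nonneg (mul_nonneg hze (mul_nonneg hz hz)) hx,
    mul_nonneg hz hze, mul_nonneg he hze, mul_nonneg he (mul_nonneg he he), mul_nonneg hze hze]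

lemma bernsteinCoeff_two_nonneg (hz : 0 ≤ z) (he : 0 ≤ e) (h : z + e ≤ 1 / 5) :
    0 ≤ 31 / 30 - 19 / 3 * e - 33 / 5 * z + 299 / 30 * e ^ 2 + 112 / 5 * z * e
      + 89 / 10 * z ^ 2 - 32 / 3 * e ^ 3 - 67 / 3 * z * e ^ 2 - 148 / 15 * z ^ 2 * e
      - 4 / 5 * z ^ 3 + 28 / 3 * z * e ^ 3 + 146 / 15 * z ^ 2 * e ^ 2 + 2 / 3 * z ^ 3 * e
      - 16 / 15 * z ^ 4 - 8 / 3 * z ^ 2 * e ^ 3 - 16 / 5 * z ^ 3 * e ^ 2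
      - 16 / 15 * z ^ 4 * e := by
  have hx : 0 ≤ 1 / 5 - z - e := by linarith
  have hze := mul_nonneg hz he
  nlinarith [mul_nonneg hx hx, mul_nonneg hx (mul_nonneg hx hx), mul_nonneg hx hz,
    mul_nonneg hx he, mul_nonneg hx hze, mul_nonneg hx (mul_nonneg he he),
    mul_nonneg hx (mul_nonneg hz hz), mul_nonneg hz (mul_nonneg hz hz),
    mul_nonneg (mul_nonneg hze hz) hx, mul_nonneg (mul_nonneg hze he) hx,
    mul_nonneg (mul_nonneg hze hze) hx, mul_nonneg (mul_nonneg hze (mul_nonneg hz hz)) hx,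
    mul_nonneg hz hze, mul_nonneg he hze, mul_nonneg he (mul_nonneg he he), mul_nonneg hze hze]

/-- The coefficient of `a * s` in the cofactor of `e * z` in `distrib_core`, with `A = a ^ 2`. -/
def linCoeff (A z e : ℝ) : ℝ :=
  (8 - 14 * e - 7 * z + 10 * z * e + z ^ 2 - 2 * z ^ 2 * e)
    + A * (-6 + 6 * e + 9 * z - 3 * z * e - 3 * z ^ 2)

/-- The part free of `s` in the cofactor of `e * z` in `distrib_core`, with `A = a ^ 2`. -/
def constCoeff (A z e : ℝ) : ℝ :=
  (10 * e * (1 - e) + 5 * z - 9 * z * e + 8 * z * e ^ 2 - 2 * z ^ 2 + 4 * z ^ 2 * e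
      - 2 * z ^ 2 * e ^ 2 - z ^ 3 * e)
    + A * (6 - 34 * e - 18 * z + 28 * e ^ 2 + 49 * z * e - 17 * z * e ^ 2 + 14 * z ^ 2
      - 17 * z ^ 2 * e + 2 * z ^ 2 * e ^ 2 - 3 * z ^ 3 + z ^ 3 * e)
    + A ^ 2 * (-2 + 4 * e - 2 * e ^ 2 + 5 * z - 6 * z * e + z * e ^ 2 - 4 * z ^ 2
      + 2 * z ^ 2 * e + z ^ 3)

lemma linCoeff_nonneg {A : ℝ} (hA1 : A ≤ 1) (hz : 0 ≤ z) (he : 0 ≤ e)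
    (h : z + e ≤ 1 / 5) : 0 ≤ linCoeff A z e := by
  have h1 : 0 ≤ 6 - 6 * e - 9 * z + 3 * z * e + 3 * z ^ 2 := by nlinarith
  unfold linCoeff
  nlinarith [mul_nonneg hz he, mul_nonneg hz hz, mul_nonneg (sub_nonneg.2 hA1) h1,
    mul_nonneg (mul_nonneg hz hz) he]

lemma linCoeff_mul_le_constCoeff {A : ℝ} (hA : 0 ≤ A) (hA1 : A ≤ 1) (hz : 0 ≤ z) (he : 0 ≤ e)
    (h : z + e ≤ 1 / 5) :
    linCoeff A z e * (4 / 15 * ((z + 2 * e) * (2 - z - 2 * e))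
      + A * (1 - z - e) * (1 - 4 / 15 * (1 - z - e))) ≤ constCoeff A z e := by
  have h0 := bernsteinCoeff_zero_nonneg hz he h
  have h1 := bernsteinCoeff_one_nonneg hz he h
  have h2 := bernsteinCoeff_two_nonneg hz he h
  have hA1' := sub_nonneg.2 hA1
  unfold linCoeff constCoeff
  linear_combination (1 - A) ^ 2 * h0 + 2 * A * (1 - A) * h1 + A ^ 2 * h2
    + 3 / 2 * sq_nonneg (A - 3 * e - z)

lemma distrib_core {a s : ℝ} (ha : 0 ≤ a) (ha1 : a ≤ 1) (hz : 0 ≤ z) (he : 0 ≤ e)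
    (h : z + e ≤ 1 / 5) (hs : s ^ 2 = (z + 2 * e) * (2 - z - 2 * e))
    (has : 0 ≤ a * (1 - z - e) + s) :
    (a * ((1 - e * (1 - z)) + (1 - z - e)) + s) ^ 2 * (1 - a ^ 2 * (1 - z - e) - a * s - e) ≤
      (2 - z) * (a ^ 2 * (2 - z - 2 * e) + 2 * a * s + (z + 2 * e))
        * ((1 - e * (1 - z)) ^ 2 - a * (1 - e * (1 - z)) * (a * (1 - z - e) + s)) := by
  have h3 : s ^ 3 = s * ((z + 2 * e) * (2 - z - 2 * e)) := by rw [← hs]; ring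
  have hid : (2 - z) * (a ^ 2 * (2 - z - 2 * e) + 2 * a * s + (z + 2 * e))
        * ((1 - e * (1 - z)) ^ 2 - a * (1 - e * (1 - z)) * (a * (1 - z - e) + s))
      - (a * ((1 - e * (1 - z)) + (1 - z - e)) + s) ^ 2 * (1 - a ^ 2 * (1 - z - e) - a * s - e)
      = e * z * (constCoeff (a ^ 2) z e + a * s * linCoeff (a ^ 2) z e) := by
    unfold constCoeff linCoeff
    ring_nf
    rw [h3, hs]
    ring
  have hA1 : a ^ 2 ≤ 1 := pow_le_one₀ ha ha1
  have hN := linCoeff_nonneg hA1 hz he h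
  have hg := linCoeff_mul_le_constCoeff (sq_nonneg a) hA1 hz he h
  have hbound : -(a * s) ≤ 4 / 15 * ((z + 2 * e) * (2 - z - 2 * e))
      + a ^ 2 * (1 - z - e) * (1 - 4 / 15 * (1 - z - e)) := by
    rw [← hs]
    have hk : 0 ≤ 1 - 8 / 15 * (1 - z - e) := by linarith
    linear_combination 4 / 15 * sq_nonneg (a * (1 - z - e) + s) + mul_nonneg (mul_nonneg ha has) hk
  have hQ := mul_le_mul_of_nonneg_left hbound hN
  have := mul_nonneg (mul_nonneg he hz)
    (show 0 ≤ constCoeff (a ^ 2) z e + a * s * linCoeff (a ^ 2) z e by linarith)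
  linarith

end PolynomialInequalities

lemma midpoint_core {b s w y : ℝ} (hb : 0 < b) (hb1 : b ≤ 1) (hs : s ^ 2 = y * (2 - y))
    (hy : 0 ≤ y) (hyw : y ≤ w) (hw : w ≤ 2 / 5)
    (hyp : b * (2 - w - y) * s + s ^ 2 ≤ b ^ 2 * ((2 - w) * w)) :
    (2 - w) * (b ^ 2 * (2 - y) + 2 * b * s + y) * (1 - b ^ 2) ≤
      4 * b ^ 2 * (1 - b ^ 2 * (1 - w / 2 - y / 2) - b * s + (w - y) / 2) := by
  have hg : 0 ≤ b * (b * w - s) * (2 - w - y) - y * (2 - y - b ^ 2 * w) := by nlinarith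
  have hw0 : 0 ≤ w := hy.trans hyw
  have hB : b ^ 2 ≤ 1 := by nlinarith
  have hB0 : 0 ≤ b ^ 2 := sq_nonneg b
  have hbw : b ^ 2 * w ≤ 2 / 5 := by nlinarith
  have hgn : 0 ≤ b * w - s := by
    by_contra hn
    push Not at hn
    nlinarith [mul_nonneg hy (show 0 ≤ 2 - y - b ^ 2 * w by nlinarith),
      mul_pos (mul_pos hb (sub_pos.2 hn)) (show 0 < 2 - w - y by linarith)]
  have h2 : y * (2 - y - b ^ 2 * w) ≤ 2 * (b * (b * w - s)) := by
    nlinarith [mul_nonneg (mul_nonneg hb.le hgn) (show 0 ≤ w + y by linarith)]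
  have h3 : y * (2 - y - b ^ 2 * w) * (2 - w * (1 - b ^ 2))
      ≤ b * (b * w - s) * (4 - 2 * w * (1 - b ^ 2)) := by
    nlinarith [show 0 ≤ 2 - w * (1 - b ^ 2) by nlinarith, mul_nonneg hb.le hgn]
  have h4 : 0 ≤ (1 - b ^ 2) * (2 * b ^ 2 * w ^ 2 - 2 * b ^ 2 * y - (1 - b ^ 2) * (2 - w) * y)
      + y * ((2 - y - b ^ 2 * w) * (2 - w * (1 - b ^ 2))) := by
    generalize b ^ 2 = B at *
    have h1 : B * w ≤ B * (2 / 5) := mul_le_mul_of_nonneg_left hw hB0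
    have h2 : (1 - B) * w ≤ (1 - B) * (2 / 5) := mul_le_mul_of_nonneg_left hw (sub_nonneg.2 hB)
    have h3 : 2 ≤ (2 - y - B * w) * (2 - w * (1 - B)) := by nlinarith
    have h4 : (1 - B) * (2 * B + (1 - B) * (2 - w)) ≤ 2 := by
      nlinarith [mul_nonneg (mul_nonneg (sub_nonneg.2 hB) (sub_nonneg.2 hB)) hw0]
    have h5 := mul_nonneg (mul_nonneg (sub_nonneg.2 hB) hB0) (sq_nonneg w)
    linear_combination y * h3 + y * h4 + 2 * h5
  linear_combination h3 + h4

section TangentCoordinates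

variable {c₁ c₂ t₁ t₂ : ℝ}

lemma four_fifths_le_mul (hc₁ : 0 < c₁) (hc₂ : 0 < c₂) (h₁ : 4 / 5 ≤ c₁ ^ 2)
    (h₂ : 4 / 5 ≤ c₂ ^ 2) : 4 / 5 ≤ c₁ * c₂ := by
  refine le_of_sq_le_sq ?_ (by positivity)
  nlinarith

lemma sq_cos_mul_sq_add_sq (h₁ : c₁ ^ 2 * (1 + t₁ ^ 2) = 1) (h₂ : c₂ ^ 2 * (1 + t₂ ^ 2) = 1) :
    (c₁ * c₂ * (1 - t₁ * t₂)) ^ 2 + (c₁ * c₂ * (t₁ + t₂)) ^ 2 = 1 := by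
  linear_combination c₂ ^ 2 * (1 + t₂ ^ 2) * h₁ + h₂

lemma sq_cos_mul_sq_sub_sq (h₁ : c₁ ^ 2 * (1 + t₁ ^ 2) = 1) (h₂ : c₂ ^ 2 * (1 + t₂ ^ 2) = 1) :
    (c₁ * c₂ * (1 + t₁ * t₂)) ^ 2 + (c₁ * c₂ * (t₁ - t₂)) ^ 2 = 1 := by
  linear_combination c₂ ^ 2 * (1 + t₂ ^ 2) * h₁ + h₂

lemma sq_sum_eq (h₁ : c₁ ^ 2 * (1 + t₁ ^ 2) = 1) (h₂ : c₂ ^ 2 * (1 + t₂ ^ 2) = 1) (a : ℝ) :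
    ((a * c₁ + t₁ * c₁) + (a * c₂ + t₂ * c₂)) ^ 2 =
      (1 + c₁ * c₂ * (1 + t₁ * t₂)) * (a ^ 2 * (1 + c₁ * c₂ * (1 - t₁ * t₂))
        + 2 * a * (c₁ * c₂ * (t₁ + t₂)) + (1 - c₁ * c₂ * (1 - t₁ * t₂))) := by
  linear_combination
    (a ^ 2 * (t₂ * c₂) ^ 2 - 2 * a * (t₂ * c₂ * c₂) + (1 - (t₂ * c₂) ^ 2)) * h₁
      + (a ^ 2 * (1 - c₁ ^ 2) - 2 * a * (t₁ * c₁ * c₁) + c₁ ^ 2) * h₂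

end TangentCoordinates

lemma nlMean_distrib_le {a b c : ℝ} (ha : a ∈ Set.Icc (0 : ℝ) 1) (hb : b ∈ Set.Icc (0 : ℝ) 1)
    (hc : c ∈ Set.Icc (0 : ℝ) 1) (h : 0 ≤ (b - a) * (c - a)) :
    nlMean a (nlMean b c) ≤ nlMean (nlMean a b) (nlMean a c) := by
  obtain ⟨c₁, t₁, hbt, hc₁, h₁, hc₁', ht₁, hp⟩ := exists_nlMean_eq
    (show |b - a| ≤ 1 from abs_le.2 ⟨by linarith [ha.2, hb.1], by linarith [ha.1, hb.2]⟩)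
  obtain ⟨c₂, t₂, hct, hc₂, h₂, hc₂', ht₂, hq⟩ := exists_nlMean_eq
    (show |c - a| ≤ 1 from abs_le.2 ⟨by linarith [ha.2, hc.1], by linarith [ha.1, hc.2]⟩)
  have hk := four_fifths_le_mul hc₁ hc₂ hc₁' hc₂'
  have hadd := sq_cos_mul_sq_add_sq h₁ h₂
  have hsub := sq_cos_mul_sq_sub_sq h₁ h₂
  have hsum := sq_sum_eq h₁ h₂ a
  have hr := nlMean_mem hb hc
  have hpq₁ := nlMean_mem ha hb
  have hpq₂ := nlMean_mem ha hc
  have htt : 0 ≤ t₁ * t₂ := by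
    rw [hbt, hct] at h
    linarith
  have hprod : nlMean a b * nlMean a c =
      a ^ 2 * (c₁ * c₂) + a * (c₁ * c₂ * (t₁ + t₂)) + c₁ * c₂ * (t₁ * t₂) := by
    rw [hp, hq]; ring
  rw [← hp, ← hq] at hsum
  set k := c₁ * c₂ with hkdef
  set e := k * (t₁ * t₂) with hedef
  set s := k * (t₁ + t₂) with hsdef
  have hk0 : 0 < k := by linarith
  have he : 0 ≤ e := by positivity
  have hsub' : (k + e) ^ 2 + (k * (t₁ - t₂)) ^ 2 = 1 := by rw [← hsub, hedef]; ring
  have hC : (k + e) ^ 2 ≤ 1 := by linarith [sq_nonneg (k * (t₁ - t₂))]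
  have hC1 : k + e ≤ 1 := (sq_le_one_iff₀ (by positivity)).1 hC
  have hz : 0 ≤ 1 - k - e := by linarith
  have hk1 : 0 ≤ a + t₁ + t₂ := by linarith [hb.1, hc.1]
  have has : 0 ≤ a * k + s := by
    have := mul_nonneg hk0.le hk1
    rw [hsdef]
    linarith
  have hL : 0 < 1 - e * (k + e) := by linarith [mul_le_of_le_one_right he hC1]
  have hrR : nlMean b c ≤ (a * k + s) / (1 - e * (k + e)) := by
    have hnum : b + c = 2 * (a + t₁ + t₂) := by linarith
    have h4 : Real.sqrt (4 + (b - c) ^ 2) = 2 * Real.sqrt (1 + (t₁ - t₂) ^ 2) := by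
      rw [show 4 + (b - c) ^ 2 = 2 ^ 2 * (1 + (t₁ - t₂) ^ 2) by rw [hbt, hct]; ring,
        Real.sqrt_mul (by norm_num), Real.sqrt_sq (by norm_num)]
    have hroot : 1 - e * (k + e) ≤ k * Real.sqrt (1 + (t₁ - t₂) ^ 2) := by
      refine le_of_sq_le_sq ?_ (by positivity)
      rw [mul_pow, Real.sq_sqrt (by positivity)]
      linear_combination mul_nonneg (sq_nonneg e) (sub_nonneg.2 hC) - hsub'
    rw [nlMean, hnum, h4, mul_div_mul_left _ _ two_ne_zero,
      div_le_div_iff₀ (by positivity) hL]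
    calc (a + t₁ + t₂) * (1 - e * (k + e))
        ≤ (a + t₁ + t₂) * (k * Real.sqrt (1 + (t₁ - t₂) ^ 2)) := by gcongr
      _ = (a * k + s) * Real.sqrt (1 + (t₁ - t₂) ^ 2) := by rw [hsdef]; ring
  refine (nlMean_le_nlMean_right ha.1 ha.2 hr.1 hr.2 hrR).trans ?_
  refine nlMean_le_nlMean (add_nonneg hpq₁.1 hpq₂.1) ?_
  have hcore := distrib_core (s := s) ha.1 ha.2 hz he (by linarith)
    (by rw [hedef]; linear_combination hadd) (by linear_combination has)
  have hadd_e : k * (1 + t₁ * t₂) = k + e := by rw [hedef]; ring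
  have hsub_e : k * (1 - t₁ * t₂) = k - e := by rw [hedef]; ring
  rw [hadd_e, hsub_e] at hsum
  rw [hprod, hsum]
  refine le_of_mul_le_mul_right ?_ (pow_pos hL 2)
  have hL' := hL.ne'
  have hR : (a * k + s) / (1 - e * (k + e)) * (1 - e * (k + e)) = a * k + s :=
    div_mul_cancel₀ _ hL'
  set R := (a * k + s) / (1 - e * (k + e))
  have e1 : (a + R) ^ 2 * (1 - (a ^ 2 * k + a * s + e)) * (1 - e * (k + e)) ^ 2
      = (a * (1 - e * (k + e)) + (a * k + s)) ^ 2 * (1 - (a ^ 2 * k + a * s + e)) := by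
    rw [← hR]; ring
  have e2 : ∀ x : ℝ, x * (1 - a * R) * (1 - e * (k + e)) ^ 2
      = x * ((1 - e * (k + e)) ^ 2 - a * (1 - e * (k + e)) * (a * k + s)) := by
    intro x
    rw [← hR]; ring
  rw [e1, e2]
  clear_value e s k
  linear_combination hcore

lemma nlMean_nlMean_le {a b d : ℝ} (ha : 0 ≤ a) (hab : a ≤ b) (hbd : b ≤ d) (hd : d ≤ 1)
    (h : nlMean a d ≤ b) : nlMean (nlMean a b) (nlMean b d) ≤ b := by
  have hb0 : 0 ≤ b := ha.trans hab
  rcases hb0.eq_or_lt with hb | hb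
  · have ha0 : a = 0 := by linarith
    have hd0 : d = 0 := by
      rw [← hb, ha0, nlMean] at h
      by_contra hne
      have : 0 < (0 + d) / Real.sqrt (4 + (0 - d) ^ 2) := by
        have : 0 < d := lt_of_le_of_ne (hb0.trans hbd) (Ne.symm hne)
        positivity
      linarith
    rw [ha0, hd0, ← hb, nlMean_self, nlMean_self]
  rw [nlMean_comm a b]
  obtain ⟨c₁, t₁, hat, hc₁, h₁, hc₁', ht₁, hp⟩ := exists_nlMean_eq
    (show |a - b| ≤ 1 from abs_le.2 ⟨by linarith, by linarith⟩)
  obtain ⟨c₂, t₂, hdt, hc₂, h₂, hc₂', ht₂, hq⟩ := exists_nlMean_eq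
    (show |d - b| ≤ 1 from abs_le.2 ⟨by linarith, by linarith⟩)
  have hk := four_fifths_le_mul hc₁ hc₂ hc₁' hc₂'
  have hadd := sq_cos_mul_sq_add_sq h₁ h₂
  have hsub := sq_cos_mul_sq_sub_sq h₁ h₂
  have hsum := sq_sum_eq h₁ h₂ b
  have hp0 : 0 ≤ nlMean b a := by
    rw [nlMean_comm]; exact ha.trans (le_nlMean ha hab (hbd.trans hd))
  have hq0 : 0 ≤ nlMean b d := hb0.trans (le_nlMean hb0 hbd hd)
  have htt : 0 ≤ -t₁ * t₂ := mul_nonneg (by linarith) (by linarith)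
  have htt' : -t₁ * t₂ ≤ 1 / 4 := by
    calc -t₁ * t₂ ≤ 1 / 2 * (1 / 2) :=
          mul_le_mul (by linarith [(abs_le.1 ht₁).1]) (abs_le.1 ht₂).2 (by linarith) (by norm_num)
      _ = 1 / 4 := by norm_num
  have hhyp : (b + t₁ + t₂) ^ 2 ≤ b ^ 2 * (1 + (t₁ - t₂) ^ 2) := by
    rw [nlMean, div_le_iff₀ (by positivity)] at h
    have := pow_le_pow_left₀ (by linarith) h 2
    rw [mul_pow, Real.sq_sqrt (by positivity), hat, hdt] at this
    linarith
  have hprod : nlMean b a * nlMean b d =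
      b ^ 2 * (c₁ * c₂) + b * (c₁ * c₂ * (t₁ + t₂)) + c₁ * c₂ * (t₁ * t₂) := by
    rw [hp, hq]; ring
  rw [← hp, ← hq] at hsum
  set k := c₁ * c₂ with hkdef
  have hk0 : 0 < k := by linarith
  have hkt := mul_nonneg hk0.le htt
  have hkt' := mul_le_mul_of_nonneg_left htt' hk0.le
  have hcore := midpoint_core (b := b) (s := k * (t₁ + t₂)) (w := 1 - k * (1 + t₁ * t₂))
    (y := 1 - k * (1 - t₁ * t₂)) hb (hbd.trans hd) (by linear_combination hadd)
    (sub_nonneg.2 (le_of_sq_le_sq (by linarith [sq_nonneg (k * (t₁ + t₂))]) zero_le_one))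
    (by linarith) (by linarith)
    (by linear_combination k ^ 2 * hhyp + b ^ 2 * hsub)
  calc nlMean (nlMean b a) (nlMean b d) ≤ nlMean b b := by
        refine nlMean_le_nlMean (by linarith) ?_
        rw [hprod, hsum]
        linear_combination hcore
    _ = b := nlMean_self b

/-- A table of values refined by inserting nonlinear means between neighbours. -/
structure IsBridge (B : ℕ → ℕ → ℝ) : Prop where
  zero_zero : B 0 0 = 0
  zero_one : B 0 1 = 1
  even : ∀ n m, B (n + 1) (2 * m) = B n m
  odd : ∀ n m, m < 2 ^ n → B (n + 1) (2 * m + 1) = nlMean (B n m) (B n (m + 1))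

namespace IsBridge

variable {B : ℕ → ℕ → ℝ} (hB : IsBridge B)

include hB

lemma mem_Icc (n : ℕ) : ∀ m ≤ 2 ^ n, B n m ∈ Set.Icc (0 : ℝ) 1 := by
  induction n with
  | zero =>
    intro m hm
    interval_cases m
    · simp [hB.zero_zero]
    · simp [hB.zero_one]
  | succ n ih =>
    intro m hm
    rw [pow_succ] at hm
    obtain ⟨k, rfl | rfl⟩ := m.even_or_odd'
    · rw [hB.even]
      exact ih k (by lia)
    · rw [hB.odd n k (by lia)]
      exact nlMean_mem (ih k (by lia)) (ih (k + 1) (by lia))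

lemma le_succ (n : ℕ) : ∀ m < 2 ^ n, B n m ≤ B n (m + 1) := by
  induction n with
  | zero =>
    intro m hm
    interval_cases m
    simp [hB.zero_zero, hB.zero_one]
  | succ n ih =>
    intro m hm
    rw [pow_succ] at hm
    obtain ⟨k, rfl | rfl⟩ := m.even_or_odd'
    · rw [hB.even, hB.odd n k (by lia)]
      exact le_nlMean (hB.mem_Icc n k (by lia)).1 (ih k (by lia))
        (hB.mem_Icc n (k + 1) (by lia)).2
    · rw [hB.odd n k (by lia), show 2 * k + 1 + 1 = 2 * (k + 1) by ring, hB.even]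
      exact nlMean_le (hB.mem_Icc n k (by lia)).1 (ih k (by lia))
        (hB.mem_Icc n (k + 1) (by lia)).2

lemma mono (n : ℕ) {i j : ℕ} (hij : i ≤ j) (hj : j ≤ 2 ^ n) : B n i ≤ B n j := by
  induction j, hij using Nat.le_induction with
  | base => exact le_rfl
  | succ j _ ih => exact (ih (by lia)).trans (hB.le_succ n j (by lia))

lemma nlMean_even_odd_le {n p q : ℕ}
    (ih : ∀ i ≤ 2 ^ n, ∀ j ≤ 2 ^ n, nlMean (B n i) (B n j) ≤ B (n + 1) (i + j))
    (hp : p ≤ 2 ^ n) (hq : q < 2 ^ n) :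
    nlMean (B (n + 1) (2 * p)) (B (n + 1) (2 * q + 1)) ≤ B (n + 2) (2 * p + (2 * q + 1)) := by
  have hP := hB.mem_Icc n p hp
  have hQ := hB.mem_Icc n q hq.le
  have hQ' := hB.mem_Icc n (q + 1) hq
  have h2 : 2 ^ (n + 1) = 2 * 2 ^ n := by ring
  rw [hB.even, hB.odd n q hq, show 2 * p + (2 * q + 1) = 2 * (p + q) + 1 by ring,
    hB.odd (n + 1) (p + q) (by lia)]
  have hsign : 0 ≤ (B n q - B n p) * (B n (q + 1) - B n p) := by
    rcases le_or_gt p q with h | h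
    · exact mul_nonneg (sub_nonneg.2 (hB.mono n h hq.le))
        (sub_nonneg.2 (hB.mono n (by lia) hq))
    · exact mul_nonneg_of_nonpos_of_nonpos (sub_nonpos.2 (hB.mono n h.le hp))
        (sub_nonpos.2 (hB.mono n h hp))
  exact (nlMean_distrib_le hP hQ hQ' hsign).trans
    (nlMean_mono (nlMean_mem hP hQ).1 (ih p hp q hq.le) (hB.mem_Icc _ _ (by lia)).2
      (nlMean_mem hP hQ').1 (ih p hp (q + 1) hq) (hB.mem_Icc _ _ (by lia)).2)

lemma nlMean_neighbours_le {n r : ℕ}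
    (ih : ∀ i ≤ 2 ^ n, ∀ j ≤ 2 ^ n, nlMean (B n i) (B n j) ≤ B (n + 1) (i + j))
    (hr : r + 2 ≤ 2 ^ (n + 1)) :
    nlMean (B (n + 1) r) (B (n + 1) (r + 2)) ≤ B (n + 1) (r + 1) := by
  rw [pow_succ] at hr
  obtain ⟨k, rfl | rfl⟩ := r.even_or_odd'
  · rw [show 2 * k + 2 = 2 * (k + 1) by ring, hB.even, hB.even, hB.odd n k (by lia)]
  · rw [show 2 * k + 1 + 2 = 2 * (k + 1) + 1 by ring, hB.odd n k (by lia),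
      hB.odd n (k + 1) (by lia), show 2 * k + 1 + 1 = 2 * (k + 1) by ring, hB.even]
    refine nlMean_nlMean_le (hB.mem_Icc n k (by lia)).1 (hB.le_succ n k (by lia))
      (hB.le_succ n (k + 1) (by lia)) (hB.mem_Icc n _ (by lia)).2 ?_
    have := ih k (by lia) (k + 1 + 1) (by lia)
    rwa [show k + (k + 1 + 1) = 2 * (k + 1) by ring, hB.even] at this

lemma nlMean_odd_odd_le {n p q : ℕ}
    (ih : ∀ i ≤ 2 ^ n, ∀ j ≤ 2 ^ n, nlMean (B n i) (B n j) ≤ B (n + 1) (i + j))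
    (hpq : p ≤ q) (hq : q < 2 ^ n) :
    nlMean (B (n + 1) (2 * p + 1)) (B (n + 1) (2 * q + 1)) ≤
      B (n + 2) (2 * p + 1 + (2 * q + 1)) := by
  have h2 : 2 ^ (n + 1) = 2 * 2 ^ n := by ring
  rw [show 2 * p + 1 + (2 * q + 1) = 2 * (p + q + 1) by ring, hB.even]
  rcases hpq.eq_or_lt with rfl | hlt
  · rw [nlMean_self, two_mul]
  rw [hB.odd n p (by lia), hB.odd n q hq]
  have ha := hB.mem_Icc n p (by lia)
  have hb := hB.mem_Icc n (p + 1) (by lia)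
  have hc := hB.mem_Icc n q hq.le
  have hd := hB.mem_Icc n (q + 1) hq
  have hab := hB.le_succ n p (by lia)
  have hbc := hB.mono n (i := p + 1) (j := q) hlt hq.le
  have hcd := hB.le_succ n q hq
  have hac := ih p (by lia) q hq.le
  have had := ih p (by lia) (q + 1) hq
  have hbc' := ih (p + 1) (by lia) q hq.le
  have hbd := ih (p + 1) (by lia) (q + 1) hq
  have hu := hB.mem_Icc (n + 1) (p + q) (by lia)
  have hm := hB.mem_Icc (n + 1) (p + q + 1) (by lia)
  have hv := hB.mem_Icc (n + 1) (p + q + 2) (by lia)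
  have hum := hB.le_succ (n + 1) (p + q) (by lia)
  have hmv := hB.le_succ (n + 1) (p + q + 1) (by lia)
  have hneigh := hB.nlMean_neighbours_le (r := p + q) ih (by lia)
  rw [show p + (q + 1) = p + q + 1 by ring] at had
  rw [show p + 1 + q = p + q + 1 by ring] at hbc'
  rw [show p + 1 + (q + 1) = p + q + 2 by ring] at hbd
  set a := B n p
  set b := B n (p + 1)
  set c := B n q
  set d := B n (q + 1)
  have hab' := nlMean_mem ha hb
  have hab_le : nlMean a b ≤ b := nlMean_le ha.1 hab hb.2
  have hleft : nlMean (nlMean a b) c ≤ nlMean (B (n + 1) (p + q)) (B (n + 1) (p + q + 1)) := by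
    rw [nlMean_comm]
    refine (nlMean_distrib_le hc ha hb (mul_nonneg_of_nonpos_of_nonpos
      (by linarith) (by linarith))).trans ?_
    rw [nlMean_comm c a, nlMean_comm c b]
    exact nlMean_mono (nlMean_mem ha hc).1 hac hu.2 (nlMean_mem hb hc).1 hbc' hm.2
  have hright : nlMean (nlMean a b) d ≤
      nlMean (B (n + 1) (p + q + 1)) (B (n + 1) (p + q + 2)) := by
    rw [nlMean_comm]
    refine (nlMean_distrib_le hd ha hb (mul_nonneg_of_nonpos_of_nonpos
      (by linarith) (by linarith))).trans ?_
    rw [nlMean_comm d a, nlMean_comm d b]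
    exact nlMean_mono (nlMean_mem ha hd).1 had hm.2 (nlMean_mem hb hd).1 hbd hv.2
  calc nlMean (nlMean a b) (nlMean c d)
      ≤ nlMean (nlMean (nlMean a b) c) (nlMean (nlMean a b) d) :=
        nlMean_distrib_le hab' hc hd (mul_nonneg (by linarith) (by linarith))
    _ ≤ nlMean (nlMean (B (n + 1) (p + q)) (B (n + 1) (p + q + 1)))
          (nlMean (B (n + 1) (p + q + 1)) (B (n + 1) (p + q + 2))) :=
        nlMean_mono (nlMean_mem hab' hc).1 hleft (nlMean_mem hu hm).2
          (nlMean_mem hab' hd).1 hright (nlMean_mem hm hv).2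
    _ ≤ B (n + 1) (p + q + 1) := nlMean_nlMean_le hu.1 hum hmv hv.2 hneigh

theorem nlMean_le_add (n : ℕ) :
    ∀ i ≤ 2 ^ n, ∀ j ≤ 2 ^ n, nlMean (B n i) (B n j) ≤ B (n + 1) (i + j) := by
  induction n with
  | zero =>
    have h01 := hB.odd 0 0 (by norm_num)
    intro i hi j hj
    interval_cases i <;> interval_cases j
    · simpa [nlMean_self] using (hB.even 0 0).ge
    · simpa using h01.ge
    · simpa [nlMean_comm] using h01.ge
    · simpa [nlMean_self] using (hB.even 0 1).ge
  | succ n ih =>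
    intro i hi j hj
    rw [pow_succ] at hi hj
    obtain ⟨p, rfl | rfl⟩ := i.even_or_odd' <;> obtain ⟨q, rfl | rfl⟩ := j.even_or_odd'
    · rw [← mul_add, hB.even, hB.even, hB.even]
      exact ih p (by lia) q (by lia)
    · exact hB.nlMean_even_odd_le ih (by lia) (by lia)
    · rw [nlMean_comm, add_comm (2 * p + 1)]
      exact hB.nlMean_even_odd_le ih (by lia) (by lia)
    · rcases le_total p q with h | h
      · exact hB.nlMean_odd_odd_le ih h (by lia)
      · rw [nlMean_comm, add_comm (2 * p + 1)]
        exact hB.nlMean_odd_odd_le ih h (by lia)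

end IsBridge

theorem bridge_midpoint_inequality
    (A : ℝ → ℝ)
    (hAcont : ContinuousOn A (Set.Icc 0 (1 / 2)))
    (hA0 : A 0 = 0) (hAhalf : A (1 / 2) = 1)
    (hArec : ∀ n : ℕ, 2 ≤ n → ∀ k : ℕ, Odd k → k < 2 ^ (n - 1) →
      A ((k : ℝ) / 2 ^ n) =
        nlMean (A (((k : ℝ) - 1) / 2 ^ n)) (A (((k : ℝ) + 1) / 2 ^ n))) :
    ∀ s ∈ Set.Icc (0 : ℝ) (1 / 2), ∀ t ∈ Set.Icc (0 : ℝ) (1 / 2),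
      nlMean (A s) (A t) ≤ A ((s + t) / 2) := by
  have hB : IsBridge fun n k => A ((k : ℝ) / 2 ^ (n + 1)) := by
    refine ⟨by simp [hA0], by simpa using hAhalf, fun n m => ?_, fun n m hm => ?_⟩
    · congr 1
      push_cast
      field_simp
      ring
    · have h := hArec (n + 2) (by lia) (2 * m + 1) (odd_two_mul_add_one m) (by
        rw [show n + 2 - 1 = n + 1 by lia, pow_succ]
        lia)
      convert h using 3
      · push_cast
        field_simp
        ring
      · push_cast
        field_simp
        ring
  have hpow : Filter.Tendsto (fun n : ℕ => (2 : ℝ) ^ (n + 1)) Filter.atTop Filter.atTop :=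
    (tendsto_pow_atTop_atTop_of_one_lt one_lt_two).comp (Filter.tendsto_add_atTop_nat 1)
  have hfloor : ∀ x ∈ Set.Icc (0 : ℝ) (1 / 2), ∀ n : ℕ, ⌊x * 2 ^ (n + 1)⌋₊ ≤ 2 ^ n := by
    intro x hx n
    refine Nat.floor_le_of_le ?_
    push_cast
    calc x * 2 ^ (n + 1) ≤ 1 / 2 * 2 ^ (n + 1) := by gcongr; exact hx.2
      _ = 2 ^ n := by ring
  have hlim : ∀ x ∈ Set.Icc (0 : ℝ) (1 / 2), Filter.Tendsto
      (fun n : ℕ => (⌊x * 2 ^ (n + 1)⌋₊ : ℝ) / 2 ^ (n + 1)) Filter.atTop (nhds x) :=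
    fun x hx => (tendsto_nat_floor_mul_div_atTop hx.1).comp hpow
  have hgrid : ∀ n k : ℕ, k ≤ 2 ^ n → (k : ℝ) / 2 ^ (n + 1) ∈ Set.Icc (0 : ℝ) (1 / 2) := by
    intro n k hk
    refine ⟨by positivity, ?_⟩
    rw [div_le_iff₀ (by positivity), pow_succ]
    have : (k : ℝ) ≤ 2 ^ n := by exact_mod_cast hk
    linarith
  have hA : ∀ x ∈ Set.Icc (0 : ℝ) (1 / 2), ∀ u : ℕ → ℝ,
      (∀ n, u n ∈ Set.Icc (0 : ℝ) (1 / 2)) → Filter.Tendsto u Filter.atTop (nhds x) →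
      Filter.Tendsto (fun n => A (u n)) Filter.atTop (nhds (A x)) := fun x hx u hu hux =>
    (hAcont x hx).tendsto.comp
      (tendsto_nhdsWithin_iff.2 ⟨hux, Filter.Eventually.of_forall hu⟩)
  intro s hs t ht
  have hmid : (s + t) / 2 ∈ Set.Icc (0 : ℝ) (1 / 2) :=
    ⟨by linarith [hs.1, ht.1], by linarith [hs.2, ht.2]⟩
  refine le_of_tendsto_of_tendsto'
    ((continuous_nlMean.tendsto (A s, A t)).comp
      ((hA s hs _ (fun n => hgrid n _ (hfloor s hs n)) (hlim s hs)).prodMk_nhds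
        (hA t ht _ (fun n => hgrid n _ (hfloor t ht n)) (hlim t ht))))
    (hA _ hmid (fun n => ((⌊s * 2 ^ (n + 1)⌋₊ : ℝ) / 2 ^ (n + 1)
      + (⌊t * 2 ^ (n + 1)⌋₊ : ℝ) / 2 ^ (n + 1)) / 2) (fun n => ?_)
      (((hlim s hs).add (hlim t ht)).div_const 2)) fun n => ?_
  · have h₁ := hgrid n _ (hfloor s hs n)
    have h₂ := hgrid n _ (hfloor t ht n)
    exact ⟨by linarith [h₁.1, h₂.1], by linarith [h₁.2, h₂.2]⟩
  · refine (hB.nlMean_le_add n _ (hfloor s hs n) _ (hfloor t ht n)).trans_eq (congrArg A ?_)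
    push_cast
    ring
end
end

section
/- The function t ↦ A(t)/t is nondecreasing on (0, 1/2]. -/
open MeasureTheory

noncomputable section

/-- The nonlinear mean is at least the arithmetic mean minus `(a+b)(b-a)²/16`. -/
lemma le_nlMean_s16 {a b : ℝ} (hab : 0 ≤ a + b) :
    (a + b) / 2 - (a + b) * (b - a) ^ 2 / 16 ≤ nlMean a b := by
  have hs : 0 < Real.sqrt (4 + (a - b) ^ 2) := Real.sqrt_pos.2 (by positivity)
  have hs2 := Real.sq_sqrt (show 0 ≤ 4 + (a - b) ^ 2 by positivity)
  unfold nlMean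
  set s := Real.sqrt (4 + (a - b) ^ 2)
  have key : (1 / 2 - (b - a) ^ 2 / 16) * s ≤ 1 := by
    rw [show (b - a) ^ 2 = s ^ 2 - 4 by rw [hs2]; ring]
    nlinarith [mul_nonneg (sq_nonneg (s - 2)) (by linarith : 0 ≤ s + 4)]
  rw [le_div_iff₀ hs]
  nlinarith [mul_le_mul_of_nonneg_left key hab]

/-- For close arguments the nonlinear mean is below the arithmetic mean by `(a+b)(b-a)²/20`. -/
lemma nlMean_le_s16 {a b : ℝ} (hab : 0 ≤ a + b) (hd : (b - a) ^ 2 ≤ 1 / 4) :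
    nlMean a b ≤ (a + b) / 2 - (a + b) * (b - a) ^ 2 / 20 := by
  have hs : 0 < Real.sqrt (4 + (a - b) ^ 2) := Real.sqrt_pos.2 (by positivity)
  unfold nlMean
  have key : 1 ≤ (1 / 2 - (b - a) ^ 2 / 20) * Real.sqrt (4 + (a - b) ^ 2) := by
    have h0 : (0 : ℝ) ≤ 1 / 2 - (b - a) ^ 2 / 20 := by linarith
    rw [← Real.sqrt_sq h0, ← Real.sqrt_mul (sq_nonneg _), Real.one_le_sqrt,
      show (a - b) ^ 2 = (b - a) ^ 2 by ring]
    have hx := sq_nonneg (b - a)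
    generalize (b - a) ^ 2 = x at *
    nlinarith [mul_nonneg hx (by linarith : 0 ≤ 1 / 4 - x), pow_nonneg hx 3]
  rw [div_le_iff₀ hs]
  nlinarith [mul_le_mul_of_nonneg_left key hab]

/-- Quantitative star-shapedness on a grid cell: `a` and `b` are the values at the consecutive
grid points `k` and `k + 1`. -/
structure CellBound (k a b : ℝ) : Prop where
  nonneg : 0 ≤ a
  le : a ≤ b
  le_one : b ≤ 1
  gap : b - a ≤ 1 / 2
  star : k * (a + b) * (b - a) ^ 2 / 4 ≤ k * b - (k + 1) * a

lemma CellBound.left_half {k a b : ℝ} (hk : 0 ≤ k) (h : CellBound k a b) :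
    CellBound (2 * k) a (nlMean a b) := by
  obtain ⟨ha, hab, hb, hd, hW⟩ := h
  have hsum : 0 ≤ a + b := by linarith
  have hlow := le_nlMean_s16 hsum
  have hup := nlMean_le_s16 hsum (by nlinarith)
  have hP : 0 ≤ (a + b) * (b - a) ^ 2 := by positivity
  have hmul : (a + b) * (b - a) ^ 2 ≤ b - a := by
    nlinarith [mul_nonneg hsum (by linarith : 0 ≤ b - a),
      mul_nonneg (mul_nonneg hsum (by linarith : 0 ≤ b - a)) (by linarith : 0 ≤ 1 / 2 - (b - a))]
  generalize nlMean a b = m at *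
  have hma : a ≤ m := by linarith
  refine ⟨ha, hma, by linarith, by linarith, ?_⟩
  have h1 : (m - a) ^ 2 ≤ (b - a) ^ 2 / 4 := by nlinarith
  have h2 : (a + m) * (m - a) ^ 2 ≤ (a + b) * ((b - a) ^ 2 / 4) :=
    mul_le_mul (by linarith) h1 (sq_nonneg _) hsum
  nlinarith [mul_le_mul_of_nonneg_left h2 hk, mul_le_mul_of_nonneg_left hlow hk]

lemma CellBound.right_half {k a b : ℝ} (hk : 1 ≤ k ∨ k = 0 ∧ a = 0) (h : CellBound k a b) :
    CellBound (2 * k + 1) (nlMean a b) b := by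
  obtain ⟨ha, hab, hb, hd, hW⟩ := h
  have hsum : 0 ≤ a + b := by linarith
  have hlow := le_nlMean_s16 hsum
  have hup := nlMean_le_s16 hsum (by nlinarith)
  have hP : 0 ≤ (a + b) * (b - a) ^ 2 := by positivity
  have hd0 : 0 ≤ b - a := by linarith
  have hmul : (a + b) * (b - a) ^ 2 ≤ b - a := by
    nlinarith [mul_nonneg hsum hd0,
      mul_nonneg (mul_nonneg hsum hd0) (by linarith : 0 ≤ 1 / 2 - (b - a))]
  generalize nlMean a b = m at *
  have hma : a ≤ m := by linarith
  have hmb : m ≤ b := by linarith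
  refine ⟨by linarith, hmb, hb, by linarith, ?_⟩
  have hsumm : m + b ≤ 3 / 2 * (a + b) := by linarith
  rcases hk with hk | ⟨rfl, rfl⟩
  · have h1 : (b - m) ^ 2 ≤ (9 / 16 * (b - a)) ^ 2 :=
      pow_le_pow_left₀ (by linarith) (by linarith) 2
    have h2 : (m + b) * (b - m) ^ 2 ≤ (3 / 2 * (a + b)) * (9 / 16 * (b - a)) ^ 2 :=
      mul_le_mul hsumm h1 (sq_nonneg _) (by positivity)
    have h3 := mul_le_mul_of_nonneg_left h2 (by linarith : 0 ≤ 2 * k + 1)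
    have h4 := mul_le_mul_of_nonneg_left hup (by linarith : 0 ≤ 2 * k + 2)
    have h5 := mul_le_mul_of_nonneg_right hk hP
    nlinarith
  · have hb2 : b ^ 3 ≤ b / 4 := by nlinarith
    have h1 : (b - m) ^ 2 ≤ (33 / 64 * b) ^ 2 :=
      pow_le_pow_left₀ (by linarith) (by nlinarith) 2
    have h2 : (m + b) * (b - m) ^ 2 ≤ (3 / 2 * (0 + b)) * (33 / 64 * b) ^ 2 :=
      mul_le_mul hsumm h1 (sq_nonneg _) (by positivity)
    nlinarith [pow_nonneg (by linarith : 0 ≤ b) 3]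

lemma nlMean_zero_one_mem : nlMean 0 1 ∈ Set.Icc (0.447 : ℝ) 0.4473 := by
  have hs : 0 < Real.sqrt 5 := Real.sqrt_pos.2 (by norm_num)
  have hs2 := Real.sq_sqrt (show (0 : ℝ) ≤ 5 by norm_num)
  have e : nlMean 0 1 = 1 / Real.sqrt 5 := by unfold nlMean; norm_num
  rw [e]
  constructor
  · rw [le_div_iff₀ hs]; nlinarith
  · rw [div_le_iff₀ hs]; nlinarith

lemma nlMean_one_mem {p : ℝ} (hp : p ∈ Set.Icc (0.447 : ℝ) 0.4473) :
    nlMean p 1 ∈ Set.Icc (0.695 : ℝ) 0.7 := by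
  obtain ⟨h1, h2⟩ := hp
  have hs : 0 < Real.sqrt (4 + (p - 1) ^ 2) := Real.sqrt_pos.2 (by positivity)
  unfold nlMean
  constructor
  · have : Real.sqrt (4 + (p - 1) ^ 2) ≤ 2.08 := by
      rw [Real.sqrt_le_left (by norm_num)]; nlinarith
    rw [le_div_iff₀ hs]; linarith
  · have : 2.07 ≤ Real.sqrt (4 + (p - 1) ^ 2) := by
      apply Real.le_sqrt_of_sq_le; nlinarith
    rw [div_le_iff₀ hs]; linarith

section Bridge

variable {A : ℝ → ℝ}

lemma bridge_midpoint
    (hArec : ∀ n : ℕ, 2 ≤ n → ∀ k : ℕ, Odd k → k < 2 ^ (n - 1) →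
      A ((k : ℝ) / 2 ^ n) =
        nlMean (A (((k : ℝ) - 1) / 2 ^ n)) (A (((k : ℝ) + 1) / 2 ^ n)))
    {n k : ℕ} (hn : 1 ≤ n) (hk : k < 2 ^ (n - 1)) :
    A ((2 * k + 1) / 2 ^ (n + 1)) = nlMean (A (k / 2 ^ n)) (A ((k + 1) / 2 ^ n)) := by
  have hlt : 2 * k + 1 < 2 ^ (n + 1 - 1) := by
    obtain ⟨m, rfl⟩ := Nat.exists_eq_add_of_le' hn
    simp only [Nat.add_sub_cancel] at *
    rw [pow_succ]; omega
  have h := hArec (n + 1) (by omega) (2 * k + 1) ⟨k, rfl⟩ hlt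
  push_cast at h
  rw [h]
  congr 2
  · rw [pow_succ]; field_simp; ring
  · rw [pow_succ]; field_simp; ring

lemma bridge_cellBound
    (hA0 : A 0 = 0) (hAhalf : A (1 / 2) = 1)
    (hArec : ∀ n : ℕ, 2 ≤ n → ∀ k : ℕ, Odd k → k < 2 ^ (n - 1) →
      A ((k : ℝ) / 2 ^ n) =
        nlMean (A (((k : ℝ) - 1) / 2 ^ n)) (A (((k : ℝ) + 1) / 2 ^ n)))
    (n k : ℕ) (hn : 3 ≤ n) (hk : k < 2 ^ (n - 1)) :
    CellBound k (A (k / 2 ^ n)) (A ((k + 1) / 2 ^ n)) := by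
  induction n, hn using Nat.le_induction generalizing k with
  | base =>
    have e4 : A (1 / 4) = nlMean 0 1 := by
      have h := bridge_midpoint hArec (n := 1) (k := 0) le_rfl (by norm_num)
      norm_num at h; norm_num at hAhalf; rw [h, hA0, hAhalf]
    have e8 : A (1 / 8) = nlMean 0 (A (1 / 4)) := by
      have h := bridge_midpoint hArec (n := 2) (k := 0) (by norm_num) (by norm_num)
      norm_num at h; norm_num; rw [h, hA0]
    have e38 : A (3 / 8) = nlMean (A (1 / 4)) 1 := by
      have h := bridge_midpoint hArec (n := 2) (k := 1) (by norm_num) (by norm_num)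
      norm_num at h; norm_num at hAhalf; norm_num; rw [h, hAhalf]
    have hp := nlMean_zero_one_mem
    rw [← e4] at hp
    have hr := nlMean_one_mem hp
    rw [← e38] at hr
    have h0 : CellBound 0 0 (A (1 / 4)) := by
      obtain ⟨h1, h2⟩ := hp
      constructor <;> norm_num <;> linarith
    have hl := h0.left_half le_rfl
    have hri := h0.right_half (Or.inr ⟨rfl, rfl⟩)
    rw [← e8] at hl hri
    obtain ⟨hp1, hp2⟩ := hp
    obtain ⟨hr1, hr2⟩ := hr
    norm_num at hk
    interval_cases k
    · norm_num at hl ⊢; rwa [hA0]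
    · norm_num at hri ⊢; exact hri
    · norm_num at hp1 hp2 hr1 hr2 ⊢
      generalize A (1 / 4) = p at *
      generalize A (3 / 8) = r at *
      refine ⟨by linarith, by linarith, by linarith, by linarith, ?_⟩
      have h1 : (r - p) ^ 2 ≤ 0.253 ^ 2 := pow_le_pow_left₀ (by linarith) (by linarith) 2
      have h2 : (p + r) * (r - p) ^ 2 ≤ 1.1473 * 0.253 ^ 2 :=
        mul_le_mul (by linarith) h1 (sq_nonneg _) (by norm_num)
      linarith
    · norm_num at hr1 hr2 hAhalf ⊢
      rw [hAhalf]
      generalize A (3 / 8) = r at *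
      refine ⟨by linarith, by linarith, by linarith, by linarith, ?_⟩
      have h1 : (1 - r) ^ 2 ≤ 0.305 ^ 2 := pow_le_pow_left₀ (by linarith) (by linarith) 2
      have h2 : (r + 1) * (1 - r) ^ 2 ≤ 1.7 * 0.305 ^ 2 :=
        mul_le_mul (by linarith) h1 (sq_nonneg _) (by norm_num)
      linarith
  | succ n hn ih =>
    obtain ⟨j, hj⟩ := Nat.even_or_odd' k
    have hjlt : j < 2 ^ (n - 1) := by
      obtain ⟨m, rfl⟩ := Nat.exists_eq_add_of_le' (by omega : 1 ≤ n)
      simp only [Nat.add_sub_cancel] at *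
      rw [pow_succ] at hk; omega
    have hc := ih j hjlt
    have hmid := bridge_midpoint hArec (by omega) hjlt
    have el : (2 * j : ℝ) / 2 ^ (n + 1) = j / 2 ^ n := by rw [pow_succ]; field_simp
    have er : (2 * j + 1 + 1 : ℝ) / 2 ^ (n + 1) = (j + 1) / 2 ^ n := by
      rw [pow_succ]; field_simp; ring
    rcases hj with rfl | rfl
    · push_cast
      rw [el, hmid]
      exact hc.left_half j.cast_nonneg
    · push_cast
      rw [er, hmid]
      refine hc.right_half ?_
      rcases Nat.eq_zero_or_pos j with rfl | hpos
      · right; simp [hA0]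
      · left; exact_mod_cast hpos

lemma bridge_grid_star
    (hA0 : A 0 = 0) (hAhalf : A (1 / 2) = 1)
    (hArec : ∀ n : ℕ, 2 ≤ n → ∀ k : ℕ, Odd k → k < 2 ^ (n - 1) →
      A ((k : ℝ) / 2 ^ n) =
        nlMean (A (((k : ℝ) - 1) / 2 ^ n)) (A (((k : ℝ) + 1) / 2 ^ n)))
    {n k l : ℕ} (hn : 3 ≤ n) (hkl : k ≤ l) (hl : l ≤ 2 ^ (n - 1)) :
    A (k / 2 ^ n) * l ≤ A (l / 2 ^ n) * k := by
  induction l, hkl using Nat.le_induction with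
  | base => exact le_rfl
  | succ l hkl ih =>
    rcases Nat.eq_zero_or_pos k with rfl | hk
    · simp [hA0]
    have hc := bridge_cellBound hA0 hAhalf hArec n l hn (by omega)
    have ih := ih (by omega)
    have hl0 : (0 : ℝ) < l := by exact_mod_cast hk.trans_le hkl
    have hW : (l + 1) * A (l / 2 ^ n) ≤ l * A ((l + 1) / 2 ^ n) := by
      have h1 := hc.star
      have h2 : 0 ≤ A (l / 2 ^ n) + A ((l + 1) / 2 ^ n) := by linarith [hc.nonneg, hc.le]
      have h3 : 0 ≤ l * (A (l / 2 ^ n) + A ((l + 1) / 2 ^ n)) *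
        (A ((l + 1) / 2 ^ n) - A (l / 2 ^ n)) ^ 2 / 4 := by positivity
      linarith
    push_cast
    refine le_of_mul_le_mul_left ?_ hl0
    have h4 := mul_le_mul_of_nonneg_right hW k.cast_nonneg
    have h5 := mul_le_mul_of_nonneg_left ih (by linarith : (0 : ℝ) ≤ l + 1)
    linarith

lemma tendsto_comp_dyadic_floor (hAcont : ContinuousOn A (Set.Icc 0 (1 / 2)))
    {t : ℝ} (ht0 : 0 ≤ t) (ht : t ≤ 1 / 2) :
    Filter.Tendsto (fun n : ℕ => (⌊t * 2 ^ n⌋₊ : ℝ) / 2 ^ n) Filter.atTop (nhds t) ∧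
    Filter.Tendsto (fun n : ℕ => A ((⌊t * 2 ^ n⌋₊ : ℝ) / 2 ^ n)) Filter.atTop (nhds (A t)) := by
  have h1 : Filter.Tendsto (fun n : ℕ => (⌊t * 2 ^ n⌋₊ : ℝ) / 2 ^ n) Filter.atTop (nhds t) :=
    (tendsto_nat_floor_mul_div_atTop ht0).comp
      (tendsto_pow_atTop_atTop_of_one_lt (by norm_num : (1 : ℝ) < 2))
  refine ⟨h1, (hAcont t ⟨ht0, ht⟩).tendsto.comp
    (tendsto_nhdsWithin_iff.2 ⟨h1, Filter.Eventually.of_forall fun n => ⟨by positivity, ?_⟩⟩)⟩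
  rw [div_le_iff₀ (by positivity)]
  exact (Nat.floor_le (by positivity)).trans (mul_le_mul_of_nonneg_right ht (by positivity))

end Bridge

theorem bridge_ratio_monotone
    (A : ℝ → ℝ)
    (hAcont : ContinuousOn A (Set.Icc 0 (1 / 2)))
    (hA0 : A 0 = 0) (hAhalf : A (1 / 2) = 1)
    (hArec : ∀ n : ℕ, 2 ≤ n → ∀ k : ℕ, Odd k → k < 2 ^ (n - 1) →
      A ((k : ℝ) / 2 ^ n) =
        nlMean (A (((k : ℝ) - 1) / 2 ^ n)) (A (((k : ℝ) + 1) / 2 ^ n))) :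
    ∀ s t : ℝ, 0 < s → s ≤ t → t ≤ 1 / 2 → A s / s ≤ A t / t := by
  intro s t hs hst ht
  have ht0 : 0 < t := hs.trans_le hst
  rw [div_le_div_iff₀ hs ht0]
  obtain ⟨s1, s2⟩ := tendsto_comp_dyadic_floor hAcont hs.le (hst.trans ht)
  obtain ⟨t1, t2⟩ := tendsto_comp_dyadic_floor hAcont ht0.le ht
  refine le_of_tendsto_of_tendsto (s2.mul t1) (t2.mul s1) ?_
  filter_upwards [Filter.eventually_ge_atTop 3] with n hn
  have hl : ⌊t * 2 ^ n⌋₊ ≤ 2 ^ (n - 1) := by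
    refine Nat.floor_le_of_le ?_
    obtain ⟨m, rfl⟩ := Nat.exists_eq_add_of_le' (by omega : 1 ≤ n)
    push_cast
    rw [pow_succ]
    nlinarith [pow_pos (by norm_num : (0 : ℝ) < 2) m]
  have h := bridge_grid_star hA0 hAhalf hArec hn
    (Nat.floor_le_floor (mul_le_mul_of_nonneg_right hst (by positivity))) hl
  simp only [mul_div_assoc']
  exact div_le_div_of_nonneg_right h (by positivity)
end
end
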